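/- arXiv:2112.14758 — 3 statements merged into one kernel-verified Lean document; each statement's English description precedes it below -/
import Mathlib

section
/- Let k ≥ 0 and d ≥ 1 be integers, N > k+1, n = N^d, and fix j ∈ {1, 2, …, k+1}. Let M_{n,d}^{(k+1-j)} be the block-diagonal matrix whose ℓ-th diagonal block (ℓ = 1, …, d) is the Kronecker product I_N ⊗ ⋯ ⊗ D_{N-j}^{(k+1-j)} ⊗ ⋯ ⊗ I_N with the order-(k+1-j) univariate difference operator on N-j points in the ℓ-th factor and identity I_N in the other d-1 factors (with the convention D_m^{(0)} = I_m). Then the order-(k+1) KTF penalty matrix factors as D_{n,d}^{(k+1)} = M_{n,d}^{(k+1-j)} D_{n,d}^{(j)}, where D_{n,d}^{(j)} is the order-j KTF penalty matrix with blocks stacked in the same order ℓ = 1, …, d. -/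
open scoped BigOperators ENNReal NNReal
open MeasureTheory ProbabilityTheory Matrix

noncomputable section

/-- Univariate forward difference matrix `D^{(1)}_M ∈ ℝ^{(M-1)×M}`, with entries
`(D^{(1)}_M)_{i,i} = -1`, `(D^{(1)}_M)_{i,i+1} = 1` and `0` otherwise. -/
def D1 (M : ℕ) : Matrix (Fin (M - 1)) (Fin M) ℝ :=
  Matrix.of fun i j => if (j : ℕ) = (i : ℕ) then -1 else if (j : ℕ) = (i : ℕ) + 1 then 1 else 0

/-- Univariate difference operator of order `m` on `N` points:
`D^{(0)}_N = I_N` and `D^{(m+1)}_N = D^{(1)}_{N-m} D^{(m)}_N`.  In particular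
`Dop N (k+1)` is the operator `D_N^{(k+1)} ∈ ℝ^{(N-k-1) × N}`. -/
def Dop (N : ℕ) : (m : ℕ) → Matrix (Fin (N - m)) (Fin N) ℝ
  | 0 => Matrix.of fun i j => if (i : ℕ) = (j : ℕ) then 1 else 0
  | m + 1 => D1 (N - m) * Dop N m

/-- Row index type of the order-`m` KTF penalty matrix: a coordinate direction `j`,
a row index of the univariate operator, and the values of the other `d-1` lattice
coordinates. -/
abbrev KtfIdx (N d m : ℕ) :=
  Σ j : Fin d, Fin (N - m) × ({l : Fin d // l ≠ j} → Fin N)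

/-- Order-`m` KTF penalty matrix on the lattice `{1,…,N}^d`: the vertical block
concatenation over coordinate directions `j` of `I_N ⊗ ⋯ ⊗ D^{(m)}_N ⊗ ⋯ ⊗ I_N`
(`D^{(m)}_N` in the `j`-th factor). -/
def ktfMat (N d m : ℕ) : Matrix (KtfIdx N d m) (Fin d → Fin N) ℝ :=
  Matrix.of fun p x =>
    Dop N m p.2.1 (x p.1) *
      ∏ l : {l : Fin d // l ≠ p.1}, (if p.2.2 l = x l.1 then (1:ℝ) else 0)

/-- The block-diagonal matrix `M_{n,d}^{(k+1-j)}` whose `ℓ`-th diagonal block is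
`I_N ⊗ ⋯ ⊗ D_{N-j}^{(k+1-j)} ⊗ ⋯ ⊗ I_N` (the order-`(k+1-j)` univariate difference
operator on `N-j` points in the `ℓ`-th factor), mapping the output index space of the
order-`j` KTF penalty matrix to that of the order-`(k+1)` one. -/
def Mblock (N d k j : ℕ) (h : N - (k + 1) = (N - j) - (k + 1 - j)) :
    Matrix (KtfIdx N d (k + 1)) (KtfIdx N d j) ℝ :=
  Matrix.of fun p q =>
    if hl : p.1 = q.1 then
      (if (fun l : {l : Fin d // l ≠ q.1} => p.2.2 ⟨l.1, fun e => l.2 (e.trans hl)⟩) = q.2.2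
        then Dop (N - j) (k + 1 - j) (Fin.cast h p.2.1) q.2.1 else 0)
    else 0

/-- Univariate composition rule `D_N^{(j+m)} = D_{N-j}^{(m)} D_N^{(j)}`, entrywise. -/
theorem Dop_add_apply (N j m : ℕ) (h : N - (j + m) = N - j - m)
    (r : Fin (N - (j + m))) (x : Fin N) :
    Dop N (j + m) r x = ∑ s, Dop (N - j) m (Fin.cast h r) s * Dop N j s x := by
  induction m with
  | zero =>
    have hD : ∀ s, Dop (N - j) 0 (Fin.cast h r) s = if r = s then 1 else 0 := fun s => by
      simp [Dop, Fin.ext_iff]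
    simp only [hD, ite_mul, one_mul, zero_mul]
    exact (Fintype.sum_ite_eq r fun s => Dop N j s x).symm
  | succ m ih =>
    have h' : N - (j + m) = N - j - m := by omega
    calc Dop N (j + (m + 1)) r x
        = ∑ t, D1 (N - (j + m)) r t * Dop N (j + m) t x := rfl
      _ = ∑ t, ∑ s, D1 (N - j - m) (Fin.cast h r) (Fin.cast h' t) *
            Dop (N - j) m (Fin.cast h' t) s * Dop N j s x := by
          refine Finset.sum_congr rfl fun t _ => ?_
          rw [ih h' t, Finset.mul_sum]
          exact Finset.sum_congr rfl fun s _ => (mul_assoc _ _ _).symm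
      _ = ∑ s, (∑ t, D1 (N - j - m) (Fin.cast h r) (Fin.cast h' t) *
            Dop (N - j) m (Fin.cast h' t) s) * Dop N j s x := by
          rw [Finset.sum_comm]
          simp only [Finset.sum_mul]
      _ = ∑ s, Dop (N - j) (m + 1) (Fin.cast h r) s * Dop N j s x := by
          refine Finset.sum_congr rfl fun s _ => congrArg (· * Dop N j s x) ?_
          exact (finCongr h').sum_comp fun t =>
            D1 (N - j - m) (Fin.cast h r) t * Dop (N - j) m t s

/-- Proposition 7: decomposition of the KTF penalty operator.
For `1 ≤ j ≤ k+1`, the order-`(k+1)` KTF penalty matrix factors as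
`D_{n,d}^{(k+1)} = M_{n,d}^{(k+1-j)} D_{n,d}^{(j)}`. -/
theorem ktf_penalty_decomposition (k d N : ℕ) (hd : 1 ≤ d) (hN : k + 1 < N)
    (j : ℕ) (hj1 : 1 ≤ j) (hj2 : j ≤ k + 1) :
    ktfMat N d (k + 1) = Mblock N d k j (by omega) * ktfMat N d j := by
  obtain ⟨m, hm⟩ := Nat.exists_eq_add_of_le hj2
  have hkm : k + 1 - j = m := by omega
  have hD : ∀ (h : N - (k + 1) = N - j - (k + 1 - j)) (r : Fin (N - (k + 1))) (x : Fin N),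
      Dop N (k + 1) r x =
        ∑ s, Dop (N - j) (k + 1 - j) (Fin.cast h r) s * Dop N j s x := by
    rw [hkm, hm]
    exact Dop_add_apply N j m
  ext ⟨l, r, y⟩ x
  rw [Matrix.mul_apply, Fintype.sum_sigma, Fintype.sum_eq_single l]
  · rw [Fintype.sum_prod_type]
    simp only [Mblock, ktfMat, Matrix.of_apply, dite_true, ite_mul, zero_mul]
    rw [hD (by omega), Finset.sum_mul]
    exact Finset.sum_congr rfl fun s _ => (mul_assoc _ _ _).trans
      (Fintype.sum_ite_eq y fun z => Dop (N - j) (k + 1 - j) (Fin.cast _ r) s *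
        (Dop N j s (x l) * ∏ i, if z i = x i.1 then (1 : ℝ) else 0)).symm
  · intro l' hl'
    simp [Mblock, hl'.symm]
end
end

section
/- Let U ⊆ ℝ^d be an open, bounded, convex set and let f ∈ BV(U), i.e., f ∈ L¹(U) with TV(f; U) < ∞. Then TV(f; U) = Σ_{j=1}^d ∫_{U_{-j}} essVar( f(·, x_{-j}); I_{x_{-j}} ) dx_{-j}, where for each j, U_{-j} = { x_{-j} ∈ ℝ^{d-1} : (x_j, x_{-j}) ∈ U for some x_j ∈ ℝ }, I_{x_{-j}} = [a_{x_{-j}}, b_{x_{-j}}] with a_{x_{-j}} = inf{ x_j : (x_j, x_{-j}) ∈ U } and b_{x_{-j}} = sup{ x_j : (x_j, x_{-j}) ∈ U }, f(·, x_{-j}) denotes f as a function of the j-th coordinate with the other coordinates fixed at x_{-j}, and essVar denotes essential (univariate) variation. -/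
open scoped BigOperators ENNReal NNReal
open MeasureTheory

noncomputable section

/-- The divergence `div φ = Σ_j ∂φ_j/∂x_j` of a vector field `φ : ℝ^d → ℝ^d`. -/
def divg (d : ℕ) (φ : (Fin d → ℝ) → (Fin d → ℝ)) (x : Fin d → ℝ) : ℝ :=
  ∑ j, fderiv ℝ (fun y => φ y j) x (Pi.single j 1)

/-- The set of values `∫_U f · div φ` over all smooth, compactly supported test vector
fields `φ` with support in `U` and `‖φ(x)‖_∞ ≤ 1` on `U`.  Its supremum is the
(anisotropic) total variation `TV(f; U)`. -/
def tvTestVals (d : ℕ) (f : (Fin d → ℝ) → ℝ) (U : Set (Fin d → ℝ)) : Set ℝ :=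
  {v | ∃ φ : (Fin d → ℝ) → (Fin d → ℝ), ContDiff ℝ (⊤ : ℕ∞) φ ∧ HasCompactSupport φ ∧
        tsupport φ ⊆ U ∧ (∀ x ∈ U, ∀ j, |φ x j| ≤ 1) ∧
        v = ∫ x in U, f x * divg d φ x}

/-- The anisotropic (measure-theoretic) total variation `TV(f; U)`. -/
def tvAniso (d : ℕ) (f : (Fin d → ℝ) → ℝ) (U : Set (Fin d → ℝ)) : ℝ :=
  sSup (tvTestVals d f U)

/-- The point of `ℝ^d` whose `j`-th coordinate is `t` and whose other coordinates are
given by `w`. -/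
def insertCoord (d : ℕ) (j : Fin d) (t : ℝ) (w : {l : Fin d // l ≠ j} → ℝ) :
    Fin d → ℝ :=
  fun l => if h : l = j then t else w ⟨l, h⟩

/-- Essential (univariate) variation of `g` on a set `I ⊆ ℝ`: the infimum, over all
functions a.e. equal to `g` on `I`, of the pointwise variation on `I`. -/
def essVar (g : ℝ → ℝ) (I : Set ℝ) : ℝ≥0∞ :=
  ⨅ (h : ℝ → ℝ) (_ : h =ᵐ[volume.restrict I] g), eVariationOn h I

open Set Filter Topology

lemma essVar_congr {g g' : ℝ → ℝ} {I : Set ℝ} (h : g =ᵐ[volume.restrict I] g') :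
    essVar g I = essVar g' I := by
  unfold essVar
  congr 1; ext k
  have : (k =ᵐ[volume.restrict I] g) ↔ (k =ᵐ[volume.restrict I] g') :=
    ⟨fun hk => hk.trans h, fun hk => hk.trans h.symm⟩
  simp only [this]

lemma lintegral_shift_sub_le_of_monotone {V : ℝ → ℝ} (hV : Monotone V) {M : ℝ}
    (h0 : ∀ x, 0 ≤ V x) (hM : ∀ x, V x ≤ M) {a b t : ℝ} (ht : 0 < t) :
    ∫⁻ s in Icc a (b - t), ENNReal.ofReal (V (s + t) - V s) ≤ ENNReal.ofReal (t * M) := by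
  rcases lt_or_ge (b - t) a with h | h
  · simp [Icc_eq_empty (not_le.2 h)]
  have hi : ∀ x y, IntervalIntegrable V volume x y := fun x y => hV.intervalIntegrable
  have hi' : ∀ x y, IntervalIntegrable (fun s => V (s + t)) volume x y := fun x y =>
    (hV.comp (monotone_id.add_const t)).intervalIntegrable
  have hint := (hi' a (b - t)).sub (hi a (b - t))
  rw [restrict_Ioc_eq_restrict_Icc.symm, ← ofReal_integral_eq_lintegral_ofReal]
  · apply ENNReal.ofReal_le_ofReal
    rw [← intervalIntegral.integral_of_le h, intervalIntegral.integral_sub (hi' _ _) (hi _ _),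
      intervalIntegral.integral_comp_add_right]
    have e1 := intervalIntegral.integral_add_adjacent_intervals (hi (a + t) (b - t)) (hi (b - t) b)
    have e2 := intervalIntegral.integral_add_adjacent_intervals (hi a (a + t)) (hi (a + t) (b - t))
    have e3 : ∫ x in a..(a + t), V x ≥ 0 :=
      intervalIntegral.integral_nonneg (by linarith) fun x _ => h0 x
    have e4 : ∫ x in (b - t)..b, V x ≤ ∫ x in (b - t)..b, M :=
      intervalIntegral.integral_mono_on (by linarith) (hi _ _) (by simp) fun x _ => hM x
    simp only [intervalIntegral.integral_const, smul_eq_mul] at e4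
    rw [sub_add_cancel]
    have : (b - (b - t)) * M = t * M := by ring
    linarith
  · exact (intervalIntegrable_iff_integrableOn_Ioc_of_le h).1 hint
  · exact ae_of_all _ fun s => sub_nonneg.2 (hV (by linarith))

lemma lintegral_shift_sub_le_eVariationOn (h : ℝ → ℝ) {a b t : ℝ} (ht : 0 < t) :
    ∫⁻ s in Icc a (b - t), ‖h (s + t) - h s‖ₑ ≤ ENNReal.ofReal t * eVariationOn h (Icc a b) := by
  by_cases hT : eVariationOn h (Icc a b) = ⊤
  · rw [hT, ENNReal.mul_top (by simpa using ht)]; exact le_top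
  have hle : ∀ x, eVariationOn h (Icc a b ∩ Iic x) ≤ eVariationOn h (Icc a b) := fun x =>
    eVariationOn.mono _ inter_subset_left
  have hne : ∀ x, eVariationOn h (Icc a b ∩ Iic x) ≠ ⊤ := fun x => ne_top_of_le_ne_top hT (hle x)
  have key := lintegral_shift_sub_le_of_monotone
    (V := fun x => (eVariationOn h (Icc a b ∩ Iic x)).toReal)
    (M := (eVariationOn h (Icc a b)).toReal) (a := a) (b := b)
    (fun x y hxy => ENNReal.toReal_mono (hne y)
      (eVariationOn.mono _ (inter_subset_inter_right _ (Iic_subset_Iic.2 hxy))))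
    (fun x => ENNReal.toReal_nonneg) (fun x => ENNReal.toReal_mono hT (hle x)) ht
  rw [ENNReal.ofReal_mul ht.le, ENNReal.ofReal_toReal hT] at key
  refine le_trans (setLIntegral_mono' measurableSet_Icc fun s hs => ?_) key
  have h1 : eVariationOn h (Icc a b ∩ Iic s) + eVariationOn h (Icc s (s + t)) ≤
      eVariationOn h (Icc a b ∩ Iic (s + t)) := by
    refine le_trans (eVariationOn.add_le_union h ?_) (eVariationOn.mono _ ?_)
    · rintro x hx y hy; exact hx.2.trans hy.1
    · rintro x (hx | hx)
      · exact ⟨hx.1, le_trans hx.2 (by linarith : s ≤ s + t)⟩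
      · exact ⟨⟨hs.1.trans hx.1, by linarith [hx.2, hs.2]⟩, hx.2⟩
  have h2 : ‖h (s + t) - h s‖ₑ ≤ eVariationOn h (Icc s (s + t)) := by
    rw [← edist_eq_enorm_sub]
    exact eVariationOn.edist_le _ (right_mem_Icc.2 (by linarith)) (left_mem_Icc.2 (by linarith))
  rw [ENNReal.ofReal_sub _ ENNReal.toReal_nonneg, ENNReal.ofReal_toReal (hne _),
    ENNReal.ofReal_toReal (hne _)]
  refine ENNReal.le_sub_of_add_le_left (hne _) (le_trans ?_ h1)
  gcongr

lemma lintegral_shift_sub_le_essVar (g : ℝ → ℝ) {a b t : ℝ} (ht : 0 < t) {S : Set ℝ}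
    (hS : ∀ s ∈ S, s ∈ Icc a b ∧ s + t ∈ Icc a b) :
    ∫⁻ s in S, ‖g (s + t) - g s‖ₑ ≤ ENNReal.ofReal t * essVar g (Icc a b) := by
  have hsub : S ⊆ Icc a (b - t) := fun s hs => ⟨(hS s hs).1.1, by linarith [(hS s hs).2.2]⟩
  refine le_trans (lintegral_mono_set hsub) ?_
  unfold essVar
  rw [ENNReal.mul_iInf_of_ne (by simpa using ht) ENNReal.ofReal_ne_top]
  refine le_iInf fun h => ?_
  rw [ENNReal.mul_iInf_of_ne (by simpa using ht) ENNReal.ofReal_ne_top]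
  refine le_iInf fun hh => le_trans (le_of_eq ?_) (lintegral_shift_sub_le_eVariationOn h ht)
  apply setLIntegral_congr_fun_ae measurableSet_Icc
  rw [EventuallyEq, ae_restrict_iff' measurableSet_Icc] at hh
  have hh' := (measurePreserving_add_right volume t).quasiMeasurePreserving.ae hh
  filter_upwards [hh, hh'] with s h1 h2 hs
  rw [h1 ⟨hs.1, by linarith [hs.2]⟩, h2 ⟨by linarith [hs.1], by linarith [hs.2]⟩]

lemma eVariationOn_average_le {g : ℝ → ℝ} (hg : Integrable g) {t : ℝ} (ht : 0 < t) (a c : ℝ) :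
    eVariationOn (fun x => t⁻¹ * ∫ s in x..x + t, g s) (Icc a c) ≤
      (ENNReal.ofReal t)⁻¹ * ∫⁻ s in Icc a c, ‖g (s + t) - g s‖ₑ := by
  have hi : ∀ x y, IntervalIntegrable g volume x y := fun x y => hg.intervalIntegrable
  have hi' : ∀ x y, IntervalIntegrable (fun s => g (s + t)) volume x y := fun x y =>
    (hg.comp_add_right t).intervalIntegrable
  have hd : ∀ x y, x ≤ y → edist (t⁻¹ * ∫ s in y..y + t, g s) (t⁻¹ * ∫ s in x..x + t, g s) ≤
      (ENNReal.ofReal t)⁻¹ * ∫⁻ s in Ioc x y, ‖g (s + t) - g s‖ₑ := by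
    intro x y hxy
    have e : (t⁻¹ * ∫ s in y..y + t, g s) - (t⁻¹ * ∫ s in x..x + t, g s) =
        t⁻¹ * ∫ s in Ioc x y, (g (s + t) - g s) := by
      rw [← intervalIntegral.integral_of_le hxy, intervalIntegral.integral_sub (hi' _ _) (hi _ _),
        intervalIntegral.integral_comp_add_right]
      have e1 := intervalIntegral.integral_add_adjacent_intervals (hi x (x + t)) (hi (x + t) (y + t))
      have e2 := intervalIntegral.integral_add_adjacent_intervals (hi x y) (hi y (y + t))
      rw [← mul_sub]
      congr 1
      linarith
    rw [edist_eq_enorm_sub, e, enorm_mul, ← ENNReal.ofReal_inv_of_pos ht,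
      Real.enorm_of_nonneg (inv_nonneg.2 ht.le)]
    gcongr
    exact enorm_integral_le_lintegral_enorm _
  refine iSup_le fun ⟨n, u, hu, us⟩ => ?_
  refine le_trans (Finset.sum_le_sum fun i _ => hd _ _ (hu (Nat.le_succ i))) ?_
  rw [← Finset.mul_sum]
  gcongr
  rw [← lintegral_biUnion_finset (t := fun i => Ioc (u i) (u (i + 1)))
    (fun i _ j _ hij => hu.pairwise_disjoint_on_Ioc_succ hij) (fun _ _ => measurableSet_Ioc)]
  refine lintegral_mono_set (iUnion₂_subset fun i _ x hx => ⟨?_, ?_⟩)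
  · exact (us i).1.trans hx.1.le
  · exact hx.2.trans (us (i + 1)).2

lemma ae_tendsto_average {g : ℝ → ℝ} (hg : Integrable g) {τ : ℕ → ℝ} (hτ : ∀ n, 0 < τ n)
    (hτ0 : Tendsto τ atTop (𝓝 0)) :
    ∀ᵐ x, Tendsto (fun n => (τ n)⁻¹ * ∫ s in x..x + τ n, g s) atTop (𝓝 (g x)) := by
  filter_upwards [LocallyIntegrable.ae_hasDerivAt_integral hg.locallyIntegrable] with x hx
  have h := (hx x).tendsto_slope_zero_right
  have h' := h.comp (tendsto_nhdsWithin_iff.2 ⟨hτ0, Eventually.of_forall hτ⟩)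
  refine h'.congr fun n => ?_
  simp

lemma essVar_le_liminf {g : ℝ → ℝ} (hg : Integrable g) {a b : ℝ} (hab : a < b)
    {τ : ℕ → ℝ} (hτ : ∀ n, 0 < τ n) (hτ0 : Tendsto τ atTop (𝓝 0)) :
    essVar g (Icc a b) ≤ liminf (fun n => (ENNReal.ofReal (τ n))⁻¹ *
      ∫⁻ s in Icc a (b - τ n), ‖g (s + τ n) - g s‖ₑ) atTop := by
  refine le_of_forall_gt fun v hv => ?_
  obtain ⟨v, hv1, hv2⟩ := exists_between hv
  refine lt_of_le_of_lt ?_ hv2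
  have hvtop : v ≠ ⊤ := hv2.ne_top
  set M : ℕ → ℝ → ℝ := fun n x => (τ n)⁻¹ * ∫ s in x..x + τ n, g s with hM
  set r : ℕ → ℝ → ℝ := fun n x => min x (b - τ n) with hr
  have hfreq := frequently_lt_of_liminf_lt (by isBoundedDefault) hv1
  have hτb : ∀ᶠ n in atTop, τ n < b - a := hτ0.eventually_lt_const (by linarith)
  have := frequently_iff_neBot.1 hfreq
  obtain ⟨𝓤, h𝓤⟩ := Ultrafilter.exists_le (atTop ⊓ 𝓟 {n | (ENNReal.ofReal (τ n))⁻¹ *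
      ∫⁻ s in Icc a (b - τ n), ‖g (s + τ n) - g s‖ₑ < v})
  have h𝓤1 : (𝓤 : Filter ℕ) ≤ atTop := h𝓤.trans inf_le_left
  have hvar : ∀ᶠ n in (𝓤 : Filter ℕ), eVariationOn (M n ∘ r n) (Icc a b) ≤ v := by
    filter_upwards [h𝓤1 hτb, le_principal_iff.1 (h𝓤.trans inf_le_right)] with n h1 h2
    refine le_trans (eVariationOn.comp_le_of_monotoneOn (M n) (s := Icc a (b - τ n)) (r n) ?_ ?_)
      ((eVariationOn_average_le hg (hτ n) a _).trans (le_of_lt h2))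
    · exact fun x _ y _ hxy => min_le_min hxy le_rfl
    · exact fun x hx => ⟨le_min hx.1 (by linarith), min_le_right _ _⟩
  have hlim : ∀ᵐ x, x ∈ Ioo a b → Tendsto (fun n => (M n ∘ r n) x) 𝓤 (𝓝 (g x)) := by
    filter_upwards [ae_tendsto_average hg hτ hτ0] with x hx hxab
    refine (hx.mono_left h𝓤1).congr' ?_
    filter_upwards [h𝓤1 (hτ0.eventually_lt_const (sub_pos.2 hxab.2))] with n hn
    have : r n x = x := min_eq_left (by linarith)
    simp only [Function.comp, this, hM]
  obtain ⟨x₀, hx₀, hx₀lim⟩ : ∃ x₀ ∈ Ioo a b, Tendsto (fun n => (M n ∘ r n) x₀) 𝓤 (𝓝 (g x₀)) := by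
    have hpos : volume.restrict (Ioo a b) ≠ 0 := by
      rw [Ne, Measure.restrict_eq_zero, Real.volume_Ioo]; simpa using hab
    have : (ae (volume.restrict (Ioo a b))).NeBot := ae_neBot.2 hpos
    have := ((ae_restrict_iff' measurableSet_Ioo).2 hlim).and
      (ae_restrict_mem (μ := volume) (measurableSet_Ioo (a := a) (b := b)))
    obtain ⟨x, h1, h2⟩ := this.exists
    exact ⟨x, h2, h1⟩
  have hconv : ∀ x ∈ Icc a b, ∃ y, Tendsto (fun n => (M n ∘ r n) x) 𝓤 (𝓝 y) := by
    intro x hx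
    have hb : ∀ᶠ n in (𝓤 : Filter ℕ), (M n ∘ r n) x ∈
        Metric.closedBall (g x₀) (v.toReal + 1) := by
      filter_upwards [hvar, hx₀lim (Metric.ball_mem_nhds (g x₀) one_pos)] with n h1 h2
      have h3 : dist ((M n ∘ r n) x) ((M n ∘ r n) x₀) ≤ v.toReal := by
        rw [dist_edist]
        exact ENNReal.toReal_mono hvtop
          ((eVariationOn.edist_le _ hx (Ioo_subset_Icc_self hx₀)).trans h1)
      have h4 : dist ((M n ∘ r n) x₀) (g x₀) < 1 := h2
      exact (dist_triangle _ _ _).trans (by linarith)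
    obtain ⟨y, -, hy⟩ := (isCompact_closedBall (g x₀) (v.toReal + 1)).ultrafilter_le_nhds
      (𝓤.map fun n => (M n ∘ r n) x) (le_principal_iff.2 hb)
    exact ⟨y, hy⟩
  choose! h hh using hconv
  have hhv : eVariationOn h (Icc a b) ≤ v := by
    refine le_of_not_gt fun hlt => ?_
    have := eVariationOn.lowerSemicontinuous_aux (F := fun n => M n ∘ r n)
      (p := (𝓤 : Filter ℕ)) (fun x hx => hh x hx) hlt
    obtain ⟨n, h1, h2⟩ := (this.and hvar).exists
    exact absurd h1 (not_lt.2 h2)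
  refine le_trans (iInf₂_le h ?_) hhv
  rw [EventuallyEq, restrict_Ioo_eq_restrict_Icc.symm, ae_restrict_iff' measurableSet_Ioo]
  filter_upwards [hlim] with x hx hxab
  exact tendsto_nhds_unique (hh x (Ioo_subset_Icc_self hxab)) (hx hxab)

section Duality

variable {E : Type*} [NormedAddCommGroup E] [NormedSpace ℝ E] [FiniteDimensional ℝ E]

/-- A smooth function with compact support in `U` and values in `[-1, 1]`. -/
def IsTestFun (U : Set E) (φ : E → ℝ) : Prop :=
  ContDiff ℝ (⊤ : ℕ∞) φ ∧ HasCompactSupport φ ∧ tsupport φ ⊆ U ∧ ∀ x, |φ x| ≤ 1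

lemma exists_smooth_cutoff {K O : Set E} (hK : IsCompact K) (hO : IsOpen O) (hKO : K ⊆ O) :
    ∃ χ : E → ℝ, ContDiff ℝ (⊤ : ℕ∞) χ ∧ HasCompactSupport χ ∧ tsupport χ ⊆ O ∧
      (∀ x, χ x ∈ Icc (0 : ℝ) 1) ∧ ∀ x ∈ K, χ x = 1 := by
  obtain ⟨δ, δpos, hδ⟩ := hK.exists_cthickening_subset_open hO hKO
  obtain ⟨χ, h1, h2, h3, h4⟩ := exists_contMDiff_support_eq_eq_one_iff (n := (⊤ : ℕ∞))
    (modelWithCornersSelf ℝ E) (Metric.isOpen_thickening (δ := δ) (E := K)) hK.isClosed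
    (Metric.self_subset_thickening δpos K)
  have hsub : tsupport χ ⊆ Metric.cthickening δ K := by
    rw [tsupport, h3]; exact Metric.closure_thickening_subset_cthickening δ K
  exact ⟨χ, h1.contDiff, HasCompactSupport.of_support_subset_isCompact
    (hK.cthickening (r := δ)) ((subset_tsupport χ).trans hsub), hsub.trans hδ,
    fun x => h2 (mem_range_self x), fun x hx => (h4 x).1 hx⟩

variable [MeasurableSpace E] [BorelSpace E] {μ : Measure E}

lemma lintegral_enorm_le_of_isTestFun [IsFiniteMeasureOnCompacts μ] {q : E → ℝ}
    (hqm : Measurable q) (hq : Integrable q μ)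
    {W : Set E} (hW : IsOpen W) {C : ℝ} (hC : ∀ ψ, IsTestFun W ψ → ∫ x, ψ x * q x ∂μ ≤ C) :
    ∫⁻ x in W, ‖q x‖ₑ ∂μ ≤ ENNReal.ofReal C := by
  set ν : Measure E := μ.withDensity fun x => ‖q x‖ₑ with hν
  have : IsFiniteMeasure ν := isFiniteMeasure_withDensity hq.2.ne
  have hνr : ∀ A, MeasurableSet A → ∫ x, A.indicator (fun x => |q x|) x ∂μ = (ν A).toReal := by
    intro A hA
    rw [integral_indicator hA, hν, withDensity_apply _ hA,
      ← integral_norm_eq_lintegral_enorm hqm.aestronglyMeasurable]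
    rfl
  have hni : ∀ A, MeasurableSet A → Integrable (A.indicator fun x => |q x|) μ :=
    fun A hA => hq.abs.indicator hA
  set P := W ∩ {x | 0 < q x} with hP
  set N := W ∩ {x | q x < 0} with hN
  have hPm : MeasurableSet P := hW.measurableSet.inter (measurableSet_lt measurable_const hqm)
  have hNm : MeasurableSet N := hW.measurableSet.inter (measurableSet_lt hqm measurable_const)
  rw [← withDensity_apply _ hW.measurableSet, ← hν, ← ENNReal.ofReal_toReal (measure_ne_top ν W)]
  apply ENNReal.ofReal_le_ofReal
  refine le_of_forall_pos_le_add fun ε hε => ?_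
  have hε4 : ENNReal.ofReal (ε / 4) ≠ 0 := by simpa using hε
  obtain ⟨K, hKP, hK, hKε⟩ := hPm.exists_isCompact_sdiff_lt (measure_ne_top ν P) hε4
  obtain ⟨L, hLN, hL, hLε⟩ := hNm.exists_isCompact_sdiff_lt (measure_ne_top ν N) hε4
  have hKL : ∀ x ∈ K, x ∉ L := fun x h1 h2 => lt_asymm (a := (0 : ℝ)) (hKP h1).2 (hLN h2).2
  obtain ⟨χ, a1, a2, a3, a4, a5⟩ := exists_smooth_cutoff hK (hW.sdiff hL.isClosed)
    (fun x hx => ⟨(hKP hx).1, hKL x hx⟩)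
  obtain ⟨ξ, b1, b2, b3, b4, b5⟩ := exists_smooth_cutoff hL (hW.sdiff hK.isClosed)
    (fun x hx => ⟨(hLN hx).1, fun h => hKL x h hx⟩)
  have hχ0 : ∀ x, x ∉ W \ L → χ x = 0 := fun x hx => image_eq_zero_of_notMem_tsupport
    fun h => hx (a3 h)
  have hξ0 : ∀ x, x ∉ W \ K → ξ x = 0 := fun x hx => image_eq_zero_of_notMem_tsupport
    fun h => hx (b3 h)
  have hψ1 : ∀ x, |χ x - ξ x| ≤ 1 := fun x => by
    rw [abs_le]; constructor <;> linarith [(a4 x).1, (a4 x).2, (b4 x).1, (b4 x).2]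
  have hψ : IsTestFun W (fun x => χ x - ξ x) := by
    refine ⟨a1.sub b1, a2.sub b2, (tsupport_sub χ ξ).trans (union_subset ?_ ?_), hψ1⟩
    · exact a3.trans sdiff_subset
    · exact b3.trans sdiff_subset
  have hψi : Integrable (fun x => (χ x - ξ x) * q x) μ :=
    hq.bdd_mul (c := 1) (a1.sub b1).continuous.aestronglyMeasurable (ae_of_all _ hψ1)
  have hpt : ∀ x, W.indicator (fun x => |q x|) x ≤ (χ x - ξ x) * q x +
      (2 * (P \ K).indicator (fun x => |q x|) x + 2 * (N \ L).indicator (fun x => |q x|) x) := by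
    intro x
    have i1 : 0 ≤ (P \ K).indicator (fun x => |q x|) x := indicator_nonneg (fun _ _ => abs_nonneg _) x
    have i2 : 0 ≤ (N \ L).indicator (fun x => |q x|) x := indicator_nonneg (fun _ _ => abs_nonneg _) x
    by_cases hxW : x ∈ W
    · rw [indicator_of_mem hxW]
      have hge : -|q x| ≤ (χ x - ξ x) * q x := by
        have : |(χ x - ξ x) * q x| ≤ |q x| := by
          rw [abs_mul]; exact mul_le_of_le_one_left (abs_nonneg _) (hψ1 x)
        exact (abs_le.1 this).1
      by_cases hxK : x ∈ K
      · rw [a5 x hxK, hξ0 x (fun h => h.2 hxK), abs_of_pos (hKP hxK).2]; linarith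
      by_cases hxL : x ∈ L
      · rw [b5 x hxL, hχ0 x (fun h => h.2 hxL), abs_of_neg (hLN hxL).2]; linarith
      rcases lt_trichotomy (q x) 0 with h | h | h
      · rw [indicator_of_mem (show x ∈ N \ L from ⟨⟨hxW, h⟩, hxL⟩)]; linarith
      · simp only [h, abs_zero, mul_zero]; linarith
      · rw [indicator_of_mem (show x ∈ P \ K from ⟨⟨hxW, h⟩, hxK⟩)]; linarith
    · rw [indicator_of_notMem hxW, hχ0 x (fun h => hxW h.1), hξ0 x (fun h => hxW h.1)]
      linarith
  have hPK := hPm.diff hK.measurableSet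
  have hNL := hNm.diff hL.measurableSet
  have hrhs := ((hni _ hPK).const_mul 2).add ((hni _ hNL).const_mul 2)
  have hfin := integral_mono (hni _ hW.measurableSet) (hψi.add hrhs) hpt
  rw [integral_add' hψi hrhs, integral_add' ((hni _ hPK).const_mul 2) ((hni _ hNL).const_mul 2),
    integral_const_mul, integral_const_mul, hνr _ hW.measurableSet, hνr _ hPK, hνr _ hNL] at hfin
  have k1 : (ν (P \ K)).toReal ≤ ε / 4 := ENNReal.toReal_le_of_le_ofReal (by linarith) hKε.le
  have k2 : (ν (N \ L)).toReal ≤ ε / 4 := ENNReal.toReal_le_of_le_ofReal (by linarith) hLε.le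
  linarith [hC _ hψ]

end Duality

section Shift

variable {E : Type*} [NormedAddCommGroup E] [NormedSpace ℝ E]

lemma IsTestFun.neg {U : Set E} {φ : E → ℝ} (h : IsTestFun U φ) :
    IsTestFun U (fun x => -φ x) := by
  obtain ⟨h1, h2, h3, h4⟩ := h
  have : tsupport (fun x => -φ x) = tsupport φ := tsupport_neg φ
  exact ⟨h1.neg, h2.neg, this ▸ h3, fun x => by rw [abs_neg]; exact h4 x⟩

lemma IsTestFun.translate {U W : Set E} {φ : E → ℝ} (h : IsTestFun W φ) {v : E}
    (hWU : ∀ x ∈ W, x + v ∈ U) : IsTestFun U (fun x => φ (x - v)) := by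
  obtain ⟨h1, h2, h3, h4⟩ := h
  refine ⟨h1.comp (contDiff_id.sub contDiff_const),
    h2.comp_homeomorph (Homeomorph.subRight v), ?_, fun x => h4 _⟩
  intro x hx
  have : x - v ∈ tsupport φ := by
    have := tsupport_comp_subset_preimage φ (f := fun x => x - v) (by fun_prop) hx
    exact this
  simpa using hWU _ (h3 this)

variable [MeasurableSpace E] [BorelSpace E] {μ : Measure E}

lemma hasDerivAt_integral_translate {F ψ : E → ℝ} (hF : Integrable F μ)
    (hψ : ContDiff ℝ (⊤ : ℕ∞) ψ) (hψc : HasCompactSupport ψ) (v : E) (s₀ : ℝ) :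
    HasDerivAt (fun s : ℝ => ∫ x, F x * ψ (x - s • v) ∂μ)
      (∫ x, F x * fderiv ℝ (fun y => -ψ (y - s₀ • v)) x v ∂μ) s₀ := by
  have hd : Differentiable ℝ ψ := hψ.differentiable (by simp)
  have hcd : Continuous (fderiv ℝ ψ) := hψ.continuous_fderiv (by simp)
  obtain ⟨B, hB⟩ := (hψc.fderiv (𝕜 := ℝ)).exists_bound_of_continuous hcd
  obtain ⟨B', hB'⟩ := hψc.exists_bound_of_continuous hψ.continuous
  have hc : ∀ s : ℝ, Continuous fun x => ψ (x - s • v) := fun s =>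
    hψ.continuous.comp (by fun_prop)
  have hfd : ∀ (s : ℝ) (x : E), fderiv ℝ (fun y => -ψ (y - s • v)) x v =
      -(fderiv ℝ ψ (x - s • v) v) := by
    intro s x
    rw [fderiv_fun_neg, fderiv_comp_sub]
    rfl
  simp only [hfd]
  refine (hasDerivAt_integral_of_dominated_loc_of_deriv_le (s := univ)
    (F := fun (s : ℝ) x => F x * ψ (x - s • v))
    (F' := fun (s : ℝ) x => F x * -(fderiv ℝ ψ (x - s • v) v))
    (bound := fun x => |F x| * (B * ‖v‖)) univ_mem ?_ ?_ ?_ ?_ ?_ ?_).2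
  · exact Eventually.of_forall fun s => hF.aestronglyMeasurable.mul (hc s).aestronglyMeasurable
  · exact hF.mul_bdd (c := B') (hc s₀).aestronglyMeasurable (ae_of_all _ fun x => hB' _)
  · refine hF.aestronglyMeasurable.mul (Continuous.aestronglyMeasurable ?_)
    have : Continuous fun x => fderiv ℝ ψ (x - s₀ • v) := hcd.comp (by fun_prop)
    fun_prop
  · refine ae_of_all _ fun x s _ => ?_
    rw [norm_mul, norm_neg, Real.norm_eq_abs]
    gcongr
    exact (ContinuousLinearMap.le_opNorm _ _).trans (by gcongr; exact hB _)
  · exact hF.abs.mul_const _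
  · refine ae_of_all _ fun x s _ => HasDerivAt.const_mul _ ?_
    have h1 : HasDerivAt (fun s : ℝ => x - s • v) (-v) s := by
      simpa using ((hasDerivAt_id s).smul_const v).const_sub x
    have h2 := (hd (x - s • v)).hasFDerivAt.comp_hasDerivAt s h1
    rw [map_neg] at h2
    exact h2

variable [FiniteDimensional ℝ E] [μ.IsAddHaarMeasure]

lemma lintegral_shift_sub_le_of_isTestFun {U : Set E} (hU : IsOpen U) (hUc : Convex ℝ U)
    {F : E → ℝ} (hFm : Measurable F) (hF : Integrable F μ) {v : E} {C : ℝ}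
    (hC : ∀ φ, IsTestFun U φ → ∫ x, F x * fderiv ℝ φ x v ∂μ ≤ C) {t : ℝ} (ht : 0 < t) :
    ∫⁻ x in U ∩ {x | x + t • v ∈ U}, ‖F (x + t • v) - F x‖ₑ ∂μ ≤ ENNReal.ofReal (t * C) := by
  have hW : IsOpen (U ∩ {x | x + t • v ∈ U}) :=
    hU.inter (hU.preimage (by fun_prop : Continuous fun x : E => x + t • v))
  have hFt : Integrable (fun x => F (x + t • v)) μ := hF.comp_add_right (t • v)
  refine lintegral_enorm_le_of_isTestFun (q := fun x => F (x + t • v) - F x)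
    ((hFm.comp (measurable_add_const _)).sub hFm) (hFt.sub hF) hW fun ψ hψ => ?_
  obtain ⟨B', hB'⟩ := hψ.2.1.exists_bound_of_continuous hψ.1.continuous
  have i1 : Integrable (fun x => F (x + t • v) * ψ x) μ :=
    hFt.mul_bdd (c := B') hψ.1.continuous.aestronglyMeasurable (ae_of_all _ hB')
  have i2 : Integrable (fun x => F x * ψ x) μ :=
    hF.mul_bdd (c := B') hψ.1.continuous.aestronglyMeasurable (ae_of_all _ hB')
  set G : ℝ → ℝ := fun s => ∫ x, F x * ψ (x - s • v) ∂μ with hG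
  have hsh : ∫ x, F (x + t • v) * ψ x ∂μ = G t := by
    simpa using integral_add_right_eq_self (μ := μ) (fun x => F x * ψ (x - t • v)) (t • v)
  have he : ∫ x, ψ x * (F (x + t • v) - F x) ∂μ = G t - G 0 := by
    rw [← hsh, hG]
    simp only [zero_smul, sub_zero]
    rw [← integral_sub i1 i2]
    congr 1; ext x; ring
  have hGd : ∀ s, HasDerivAt G (∫ x, F x * fderiv ℝ (fun y => -ψ (y - s • v)) x v ∂μ) s :=
    fun s => hasDerivAt_integral_translate hF hψ.1 hψ.2.1 v s
  have := (convex_Icc (0 : ℝ) t).image_sub_le_mul_sub_of_deriv_le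
    (fun s _ => (hGd s).continuousAt.continuousWithinAt)
    (fun s _ => (hGd s).differentiableAt.differentiableWithinAt) (C := C) ?_
    0 (left_mem_Icc.2 ht.le) t (right_mem_Icc.2 ht.le) ht.le
  · rw [he]; linarith
  · intro s hs
    rw [interior_Icc] at hs
    rw [(hGd s).deriv]
    refine hC _ (IsTestFun.neg (hψ.translate fun x hx => ?_))
    have := hUc hx.1 hx.2 (a := 1 - s / t) (b := s / t)
      (sub_nonneg.2 ((div_le_one ht).2 hs.2.le)) (div_nonneg hs.1.le ht.le) (by ring)
    convert this using 1
    rw [smul_add, smul_smul, div_mul_cancel₀ _ ht.ne', ← add_assoc, ← add_smul]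
    simp

lemma ofReal_integral_mul_fderiv_le {U : Set E} (hU : IsOpen U) {F : E → ℝ}
    (hF : Integrable F μ) {v : E} {R : ℝ≥0∞}
    (hR : ∀ t : ℝ, 0 < t → ∫⁻ x in U ∩ {x | x + t • v ∈ U}, ‖F (x + t • v) - F x‖ₑ ∂μ ≤
      ENNReal.ofReal t * R) {φ : E → ℝ} (hφ : IsTestFun U φ) :
    ENNReal.ofReal (∫ x, F x * fderiv ℝ φ x v ∂μ) ≤ R := by
  obtain ⟨h1, h2, h3, h4⟩ := hφ
  obtain ⟨L, hL⟩ := h1.lipschitzWith_of_hasCompactSupport h2 (by simp)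
  have hlim := hL.integral_inv_smul_sub_mul_tendsto_integral_lineDeriv_mul hF (-v)
  have hd : Differentiable ℝ φ := h1.differentiable (by simp)
  have e : ∫ x, lineDeriv ℝ φ x (-v) * F x ∂μ = -∫ x, F x * fderiv ℝ φ x v ∂μ := by
    rw [← integral_neg]
    congr 1; ext x
    rw [(hd x).lineDeriv_eq_fderiv, map_neg]; ring
  rw [e] at hlim
  have hlim' := hlim.enorm
  refine (Real.ofReal_le_enorm _).trans ?_
  rw [← enorm_neg]
  refine le_of_tendsto hlim' ?_
  have hsupp : ∀ᶠ t in 𝓝[>] (0 : ℝ), ∀ x ∈ tsupport φ, x + t • v ∈ U := by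
    apply nhdsWithin_le_nhds
    refine h2.isCompact.eventually_forall_of_forall_eventually fun x hx => ?_
    have hc : Continuous fun p : ℝ × E => p.2 + p.1 • v := by fun_prop
    refine hc.continuousAt.eventually_mem (hU.mem_nhds ?_)
    simpa using h3 hx
  filter_upwards [hsupp, self_mem_nhdsWithin] with t ht (ht0 : 0 < t)
  have hFt : Integrable (fun x => F (x + t • v)) μ := hF.comp_add_right (t • v)
  have hcs : Continuous fun x => φ (x + t • -v) := h1.continuous.comp (by fun_prop)
  have i0 : Integrable (fun x => φ (x + t • -v) * F x) μ :=
    hF.bdd_mul (c := 1) hcs.aestronglyMeasurable (ae_of_all _ fun x => h4 _)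
  have i1 : Integrable (fun x => φ x * F (x + t • v)) μ :=
    hFt.bdd_mul (c := 1) h1.continuous.aestronglyMeasurable (ae_of_all _ h4)
  have i2 : Integrable (fun x => φ x * F x) μ :=
    hF.bdd_mul (c := 1) h1.continuous.aestronglyMeasurable (ae_of_all _ h4)
  have hsh : ∫ x, φ (x + t • -v) * F x ∂μ = ∫ x, φ x * F (x + t • v) ∂μ := by
    rw [← integral_add_right_eq_self _ (t • v)]
    simp
  have e2 : ∫ x, (t⁻¹ • (φ (x + t • -v) - φ x)) * F x ∂μ =
      t⁻¹ * ∫ x, φ x * (F (x + t • v) - F x) ∂μ := by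
    simp only [smul_eq_mul, mul_assoc, integral_const_mul]
    simp only [sub_mul, mul_sub]
    rw [integral_sub i0 i2, integral_sub i1 i2, hsh]
  rw [e2, enorm_mul, Real.enorm_of_nonneg (inv_nonneg.2 ht0.le), ENNReal.ofReal_inv_of_pos ht0]
  have h5 : ‖∫ x, φ x * (F (x + t • v) - F x) ∂μ‖ₑ ≤ ENNReal.ofReal t * R := by
    refine (enorm_integral_le_lintegral_enorm _).trans (le_trans ?_ (hR t ht0))
    have hW : IsOpen (U ∩ {x | x + t • v ∈ U}) :=
      hU.inter (hU.preimage (by fun_prop : Continuous fun x : E => x + t • v))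
    rw [← lintegral_indicator hW.measurableSet]
    refine lintegral_mono fun x => ?_
    by_cases hx : x ∈ tsupport φ
    · rw [indicator_of_mem (show x ∈ U ∩ {x | x + t • v ∈ U} from ⟨h3 hx, ht x hx⟩), enorm_mul]
      refine mul_le_of_le_one_left' ?_
      rw [Real.enorm_eq_ofReal_abs]
      exact ENNReal.ofReal_le_one.2 (h4 x)
    · simp [image_eq_zero_of_notMem_tsupport hx]
  calc _ ≤ (ENNReal.ofReal t)⁻¹ * (ENNReal.ofReal t * R) := by gcongr
    _ = R := ENNReal.inv_mul_cancel_left (by simpa using ht0) ENNReal.ofReal_ne_top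

end Shift

section Slices

variable {d : ℕ} (j : Fin d)

lemma insertCoord_add (s t : ℝ) (w : {l : Fin d // l ≠ j} → ℝ) :
    insertCoord d j (s + t) w = insertCoord d j s w + t • Pi.single j 1 := by
  ext l
  by_cases h : l = j
  · subst h; simp [insertCoord]
  · simp [insertCoord, h]

lemma continuous_insertCoord :
    Continuous fun p : ({l : Fin d // l ≠ j} → ℝ) × ℝ => insertCoord d j p.2 p.1 := by
  refine continuous_pi fun l => ?_
  by_cases h : l = j
  · simp only [insertCoord, h, dite_true]; fun_prop
  · simp only [insertCoord, h, dite_false]; fun_prop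

lemma measurePreserving_insertCoord :
    MeasurePreserving (fun p : ({l : Fin d // l ≠ j} → ℝ) × ℝ => insertCoord d j p.2 p.1)
      (volume.prod volume) volume := by
  have h1 := (volume_preserving_piEquivPiSubtypeProd (fun _ : Fin d => ℝ) (· = j)).symm
  rw [Subsingleton.elim (Subtype.fintype fun l => l = j) (Fintype.subtypeEq j)] at h1
  have h2 : MeasurePreserving (MeasurableEquiv.funUnique {l : Fin d // l = j} ℝ).symm
      volume volume := by
    convert (volume_preserving_funUnique {l : Fin d // l = j} ℝ).symm
  have h3 : MeasurePreserving (fun p : ({l : Fin d // l ≠ j} → ℝ) × ℝ =>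
      ((MeasurableEquiv.funUnique {l : Fin d // l = j} ℝ).symm p.2, p.1))
      (volume.prod volume) volume := (h2.prod (MeasurePreserving.id
    (volume : Measure ({l : Fin d // ¬ l = j} → ℝ)))).comp Measure.measurePreserving_swap
  exact h1.comp h3

lemma slice_bounds {U : Set (Fin d → ℝ)} (hUo : IsOpen U) (hUb : Bornology.IsBounded U)
    (hUc : Convex ℝ U) {w : {l : Fin d // l ≠ j} → ℝ} (hw : ∃ t, insertCoord d j t w ∈ U) :
    sInf {t | insertCoord d j t w ∈ U} < sSup {t | insertCoord d j t w ∈ U} ∧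
    Ioo (sInf {t | insertCoord d j t w ∈ U}) (sSup {t | insertCoord d j t w ∈ U}) ⊆
      {t | insertCoord d j t w ∈ U} ∧
    {t | insertCoord d j t w ∈ U} ⊆
      Icc (sInf {t | insertCoord d j t w ∈ U}) (sSup {t | insertCoord d j t w ∈ U}) := by
  set I := {t | insertCoord d j t w ∈ U} with hI
  have hopen : IsOpen I := hUo.preimage
    ((continuous_insertCoord j).comp (by fun_prop : Continuous fun t : ℝ => (w, t)))
  have hconv : Convex ℝ I := by
    intro x hx y hy a b ha hb hab
    have := hUc hx hy ha hb hab
    rw [hI, mem_ofPred_eq]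
    convert this using 1
    ext l
    by_cases h : l = j
    · simp [insertCoord, h]
    · simp [insertCoord, h, ← add_mul, hab]
  obtain ⟨R, hR⟩ := hUb.subset_closedBall 0
  have hIR : I ⊆ Icc (-R) R := by
    intro t ht
    have h1 : ‖insertCoord d j t w‖ ≤ R := by simpa using hR ht
    have h2 := (norm_le_pi_norm (insertCoord d j t w) j).trans h1
    simp only [insertCoord, dite_true, Real.norm_eq_abs] at h2
    exact abs_le.1 h2
  have hbb : BddBelow I := bddBelow_Icc.mono hIR
  have hba : BddAbove I := bddAbove_Icc.mono hIR
  have hsub := subset_Icc_csInf_csSup hbb hba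
  refine ⟨?_, IsConnected.Ioo_csInf_csSup_subset ⟨hw, hconv.isPreconnected⟩ hbb hba, hsub⟩
  by_contra hle
  have h0 := hopen.measure_pos volume hw
  have h1 := measure_mono (μ := volume) hsub
  rw [Real.volume_Icc, ENNReal.ofReal_of_nonpos (by linarith)] at h1
  exact absurd h1 (not_le.2 h0)

lemma lintegral_shift_sub_eq_slices {U : Set (Fin d → ℝ)} (hUo : IsOpen U)
    {F : (Fin d → ℝ) → ℝ} (hFm : Measurable F) (t : ℝ) :
    (Measurable fun w : {l : Fin d // l ≠ j} → ℝ =>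
      ∫⁻ s in {s | insertCoord d j s w ∈ U ∧ insertCoord d j (s + t) w ∈ U},
        ‖F (insertCoord d j (s + t) w) - F (insertCoord d j s w)‖ₑ) ∧
    ∫⁻ x in U ∩ {x | x + t • Pi.single j 1 ∈ U}, ‖F (x + t • Pi.single j 1) - F x‖ₑ =
      ∫⁻ w : {l : Fin d // l ≠ j} → ℝ,
        ∫⁻ s in {s | insertCoord d j s w ∈ U ∧ insertCoord d j (s + t) w ∈ U},
          ‖F (insertCoord d j (s + t) w) - F (insertCoord d j s w)‖ₑ := by
  set W : Set (Fin d → ℝ) := U ∩ {x | x + t • Pi.single j 1 ∈ U} with hW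
  have hWm : MeasurableSet W := hUo.measurableSet.inter
    (hUo.measurableSet.preimage (measurable_add_const _))
  set G : (Fin d → ℝ) → ℝ≥0∞ := W.indicator fun x => ‖F (x + t • Pi.single j 1) - F x‖ₑ with hG
  have hGm : Measurable G :=
    ((hFm.comp (measurable_add_const _)).sub hFm).enorm.indicator hWm
  have hmp := measurePreserving_insertCoord j
  have hGc := hGm.comp hmp.measurable
  have e : ∀ w : {l : Fin d // l ≠ j} → ℝ,
      ∫⁻ s in {s | insertCoord d j s w ∈ U ∧ insertCoord d j (s + t) w ∈ U},
        ‖F (insertCoord d j (s + t) w) - F (insertCoord d j s w)‖ₑ =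
      ∫⁻ s, G (insertCoord d j s w) := by
    intro w
    have hc : Measurable fun s => insertCoord d j s w := hmp.measurable.comp (by fun_prop :
      Measurable fun s : ℝ => (w, s))
    have hm : MeasurableSet {s | insertCoord d j s w ∈ U ∧ insertCoord d j (s + t) w ∈ U} := by
      simp only [insertCoord_add]
      exact hc hWm
    rw [← lintegral_indicator hm]
    congr 1; ext s
    simp only [hG, insertCoord_add]
    rfl
  simp only [e]
  refine ⟨hGc.lintegral_prod_right', ?_⟩
  rw [← lintegral_indicator hWm, ← hmp.lintegral_comp hGm]
  exact lintegral_prod _ hGc.aemeasurable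

/-- The directional variation of `f` computed from its one-dimensional slices. -/
def sliceVar (j : Fin d) (U : Set (Fin d → ℝ)) (f : (Fin d → ℝ) → ℝ) : ℝ≥0∞ :=
  ∫⁻ w in {w : {l : Fin d // l ≠ j} → ℝ | ∃ t, insertCoord d j t w ∈ U},
    essVar (fun t => f (insertCoord d j t w))
      (Icc (sInf {t | insertCoord d j t w ∈ U}) (sSup {t | insertCoord d j t w ∈ U}))

lemma isOpen_projection {U : Set (Fin d → ℝ)} (hUo : IsOpen U) :
    IsOpen {w : {l : Fin d // l ≠ j} → ℝ | ∃ t, insertCoord d j t w ∈ U} := by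
  rw [Set.ofPred_exists]
  exact isOpen_iUnion fun t => hUo.preimage ((continuous_insertCoord j).comp
    (by fun_prop : Continuous fun w : {l : Fin d // l ≠ j} → ℝ => (w, t)))

lemma sliceVar_congr {U : Set (Fin d → ℝ)} (hUo : IsOpen U) (hUb : Bornology.IsBounded U)
    (hUc : Convex ℝ U) {f F : (Fin d → ℝ) → ℝ} (hfF : f =ᵐ[volume.restrict U] F) :
    sliceVar j U f = sliceVar j U F := by
  rw [EventuallyEq, ae_restrict_iff' hUo.measurableSet] at hfF
  have h := Measure.ae_ae_of_ae_prod ((measurePreserving_insertCoord j).quasiMeasurePreserving.ae hfF)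
  refine setLIntegral_congr_fun_ae (isOpen_projection j hUo).measurableSet ?_
  filter_upwards [h] with w hw hwp
  obtain ⟨-, h2, -⟩ := slice_bounds j hUo hUb hUc hwp
  apply essVar_congr
  rw [EventuallyEq, restrict_Ioo_eq_restrict_Icc.symm, ae_restrict_iff' measurableSet_Ioo]
  filter_upwards [hw] with s hs hsI
  exact hs (h2 hsI)

lemma lintegral_shift_sub_le_sliceVar {U : Set (Fin d → ℝ)} (hUo : IsOpen U)
    (hUb : Bornology.IsBounded U) (hUc : Convex ℝ U) {F : (Fin d → ℝ) → ℝ} (hFm : Measurable F)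
    {t : ℝ} (ht : 0 < t) :
    ∫⁻ x in U ∩ {x | x + t • Pi.single j 1 ∈ U}, ‖F (x + t • Pi.single j 1) - F x‖ₑ ≤
      ENNReal.ofReal t * sliceVar j U F := by
  rw [(lintegral_shift_sub_eq_slices j hUo hFm t).2, sliceVar,
    ← lintegral_const_mul' _ _ ENNReal.ofReal_ne_top,
    ← lintegral_indicator (isOpen_projection j hUo).measurableSet]
  refine lintegral_mono fun w => ?_
  by_cases hw : ∃ t, insertCoord d j t w ∈ U
  · rw [indicator_of_mem (show w ∈ {w | ∃ t, insertCoord d j t w ∈ U} from hw)]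
    obtain ⟨-, -, h3⟩ := slice_bounds j hUo hUb hUc hw
    exact lintegral_shift_sub_le_essVar (fun s => F (insertCoord d j s w)) ht
      fun s hs => ⟨h3 hs.1, h3 hs.2⟩
  · have : {s | insertCoord d j s w ∈ U ∧ insertCoord d j (s + t) w ∈ U} = ∅ :=
      eq_empty_of_forall_notMem fun s hs => hw ⟨s, hs.1⟩
    simp [this]

lemma sliceVar_le {U : Set (Fin d → ℝ)} (hUo : IsOpen U)
    (hUb : Bornology.IsBounded U) (hUc : Convex ℝ U) {F : (Fin d → ℝ) → ℝ} (hFm : Measurable F)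
    (hF : Integrable F) {C : ℝ≥0∞} (hC : ∀ t : ℝ, 0 < t →
      ∫⁻ x in U ∩ {x | x + t • Pi.single j 1 ∈ U}, ‖F (x + t • Pi.single j 1) - F x‖ₑ ≤
        ENNReal.ofReal t * C) :
    sliceVar j U F ≤ C := by
  set τ : ℕ → ℝ := fun n => 1 / ((n : ℝ) + 1) with hτdef
  have hτ : ∀ n, 0 < τ n := fun n => Nat.one_div_pos_of_nat
  have hτ0 : Tendsto τ atTop (𝓝 0) := tendsto_one_div_add_atTop_nhds_zero_nat
  set H : ℕ → ({l : Fin d // l ≠ j} → ℝ) → ℝ≥0∞ := fun n w => (ENNReal.ofReal (τ n))⁻¹ *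
    ∫⁻ s in {s | insertCoord d j s w ∈ U ∧ insertCoord d j (s + τ n) w ∈ U},
      ‖F (insertCoord d j (s + τ n) w) - F (insertCoord d j s w)‖ₑ with hH
  have hHm : ∀ n, Measurable (H n) := fun n =>
    (lintegral_shift_sub_eq_slices j hUo hFm (τ n)).1.const_mul _
  have hint : ∀ᵐ w : {l : Fin d // l ≠ j} → ℝ, Integrable fun s => F (insertCoord d j s w) :=
    ((measurePreserving_insertCoord j).integrable_comp_of_integrable hF).prod_right_ae
  have hle : sliceVar j U F ≤ ∫⁻ w, liminf (fun n => H n w) atTop := by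
    refine le_trans ?_ (setLIntegral_le_lintegral
      {w : {l : Fin d // l ≠ j} → ℝ | ∃ t, insertCoord d j t w ∈ U} _)
    refine setLIntegral_mono_ae' (isOpen_projection j hUo).measurableSet ?_
    filter_upwards [hint] with w hw hwp
    obtain ⟨h1, h2, -⟩ := slice_bounds j hUo hUb hUc hwp
    refine (essVar_le_liminf hw h1 hτ hτ0).trans (liminf_le_liminf (Eventually.of_forall fun n => ?_))
    simp only [hH]
    refine mul_le_mul_right ?_ _
    rw [restrict_Ioo_eq_restrict_Icc.symm]
    refine lintegral_mono_set fun s hs => ⟨h2 ⟨hs.1, ?_⟩, h2 ⟨?_, ?_⟩⟩ <;>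
      linarith [hs.1, hs.2, hτ n]
  refine hle.trans ((lintegral_liminf_le hHm).trans ?_)
  refine liminf_le_of_frequently_le' (Frequently.of_forall fun n => ?_)
  simp only [hH]
  rw [lintegral_const_mul _ (lintegral_shift_sub_eq_slices j hUo hFm (τ n)).1,
    ← (lintegral_shift_sub_eq_slices j hUo hFm (τ n)).2]
  calc _ ≤ (ENNReal.ofReal (τ n))⁻¹ * (ENNReal.ofReal (τ n) * C) := by gcongr; exact hC _ (hτ n)
    _ = C := ENNReal.inv_mul_cancel_left (by simpa using hτ n) ENNReal.ofReal_ne_top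

end Slices

section Components

variable {d : ℕ} {U : Set (Fin d → ℝ)}

lemma IsTestFun.integrable_mul_fderiv {F φ : (Fin d → ℝ) → ℝ} (hF : Integrable F)
    (hφ : IsTestFun U φ) (v : Fin d → ℝ) : Integrable fun x => F x * fderiv ℝ φ x v := by
  have hcd : Continuous fun x => fderiv ℝ φ x v :=
    (hφ.1.continuous_fderiv (by simp)).clm_apply continuous_const
  obtain ⟨B, hB⟩ := (hφ.2.1.fderiv_apply (𝕜 := ℝ) v).exists_bound_of_continuous hcd
  exact hF.mul_bdd (c := B) hcd.aestronglyMeasurable (ae_of_all _ hB)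

lemma integral_mul_divg_eq {f F : (Fin d → ℝ) → ℝ} (hF : Integrable F)
    (hfF : f =ᵐ[volume.restrict U] F) {φ : (Fin d → ℝ) → Fin d → ℝ}
    (hφ : ∀ j, IsTestFun U fun x => φ x j) :
    ∫ x in U, f x * divg d φ x = ∑ j, ∫ x, F x * fderiv ℝ (fun y => φ y j) x (Pi.single j 1) := by
  have hz : ∀ x, x ∉ U → ∑ j, F x * fderiv ℝ (fun y => φ y j) x (Pi.single j 1) = 0 := by
    intro x hx
    refine Finset.sum_eq_zero fun j _ => ?_
    have : x ∉ tsupport (fderiv ℝ fun y => φ y j) := fun h =>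
      hx ((hφ j).2.2.1 (tsupport_fderiv_subset ℝ h))
    simp [image_eq_zero_of_notMem_tsupport this]
  rw [← integral_finsetSum _ fun j _ => (hφ j).integrable_mul_fderiv hF _,
    ← setIntegral_eq_integral_of_forall_compl_eq_zero hz]
  refine integral_congr_ae ?_
  filter_upwards [hfF] with x hx
  rw [hx, divg, Finset.mul_sum]

lemma isTestFun_component {φ : (Fin d → ℝ) → Fin d → ℝ} (h1 : ContDiff ℝ (⊤ : ℕ∞) φ)
    (h2 : HasCompactSupport φ) (h3 : tsupport φ ⊆ U) (h4 : ∀ x ∈ U, ∀ j, |φ x j| ≤ 1)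
    (j : Fin d) : IsTestFun U fun x => φ x j := by
  refine ⟨contDiff_pi.1 h1 j, h2.comp_left (g := fun v : Fin d → ℝ => v j) rfl,
    (tsupport_comp_subset (g := fun v : Fin d → ℝ => v j) rfl φ).trans h3, fun x => ?_⟩
  by_cases hx : x ∈ U
  · exact h4 x hx j
  · simp [image_eq_zero_of_notMem_tsupport fun h => hx (h3 h)]

lemma sum_integral_mem_tvTestVals {f F : (Fin d → ℝ) → ℝ}
    (hF : Integrable F) (hfF : f =ᵐ[volume.restrict U] F) {φ : Fin d → (Fin d → ℝ) → ℝ}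
    (hφ : ∀ j, IsTestFun U (φ j)) :
    ∑ j, ∫ x, F x * fderiv ℝ (φ j) x (Pi.single j 1) ∈ tvTestVals d f U := by
  have hsupp : tsupport (fun x j => φ j x) ⊆ ⋃ j, tsupport (φ j) := by
    refine closure_minimal (fun x hx => ?_) (isClosed_iUnion_of_finite fun j => isClosed_tsupport _)
    obtain ⟨j, hj⟩ := Function.ne_iff.1 (Function.mem_support.1 hx)
    exact mem_iUnion.2 ⟨j, subset_tsupport _ hj⟩
  refine ⟨fun x j => φ j x, contDiff_pi.2 fun j => (hφ j).1, ?_, ?_, fun x _ j => (hφ j).2.2.2 x,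
    (integral_mul_divg_eq hF hfF hφ).symm⟩
  · exact (isCompact_iUnion fun j => (hφ j).2.1.isCompact).of_isClosed_subset
      (isClosed_tsupport _) hsupp
  · exact hsupp.trans (iUnion_subset fun j => (hφ j).2.2.1)

lemma isTestFun_zero : IsTestFun U fun _ => 0 :=
  ⟨contDiff_const, HasCompactSupport.zero, by simp [tsupport], by simp⟩

/-- The integrals of `F` against the `j`-th partial derivatives of scalar test functions. -/
def partialTestVals (U : Set (Fin d → ℝ)) (F : (Fin d → ℝ) → ℝ) (j : Fin d) : Set ℝ :=
  {v | ∃ φ, IsTestFun U φ ∧ v = ∫ x, F x * fderiv ℝ φ x (Pi.single j 1)}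

lemma bddAbove_partialTestVals {f F : (Fin d → ℝ) → ℝ}
    (hF : Integrable F) (hfF : f =ᵐ[volume.restrict U] F) (hBV : BddAbove (tvTestVals d f U))
    (j : Fin d) : BddAbove (partialTestVals U F j) := by
  refine hBV.mono ?_
  rintro v ⟨φ, hφ, rfl⟩
  have h := sum_integral_mem_tvTestVals hF hfF
    (φ := fun i => if i = j then φ else fun _ => 0) fun i => by
      by_cases h : i = j <;> simp [h, hφ, isTestFun_zero]
  rw [Finset.sum_eq_single j (fun i _ hi => by simp [hi]) (by simp)] at h
  simpa using h

lemma zero_mem_partialTestVals (F : (Fin d → ℝ) → ℝ) (j : Fin d) :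
    (0 : ℝ) ∈ partialTestVals U F j := ⟨fun _ => 0, isTestFun_zero, by simp⟩

lemma sum_sSup_partialTestVals_le {f F : (Fin d → ℝ) → ℝ}
    (hF : Integrable F) (hfF : f =ᵐ[volume.restrict U] F) (hBV : BddAbove (tvTestVals d f U)) :
    ∑ j, sSup (partialTestVals U F j) ≤ tvAniso d f U := by
  refine le_of_forall_pos_le_add fun ε hε => ?_
  have hδ : 0 < ε / (d + 1) := by positivity
  have : ∀ j, ∃ φ, IsTestFun U φ ∧ sSup (partialTestVals U F j) - ε / (d + 1) <
      ∫ x, F x * fderiv ℝ φ x (Pi.single j 1) := by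
    intro j
    obtain ⟨v, ⟨φ, hφ, rfl⟩, hv⟩ := exists_lt_of_lt_csSup ⟨0, zero_mem_partialTestVals (U := U) F j⟩
      (sub_lt_self _ hδ)
    exact ⟨φ, hφ, hv⟩
  choose φ hφ hlt using this
  have h1 := le_csSup hBV (sum_integral_mem_tvTestVals hF hfF hφ)
  have h2 := Finset.sum_le_sum fun j (_ : j ∈ Finset.univ) => (hlt j).le
  rw [Finset.sum_sub_distrib] at h2
  have h3 : ∑ _j : Fin d, ε / ((d : ℝ) + 1) ≤ ε := by
    rw [Finset.sum_const, Finset.card_univ, Fintype.card_fin, nsmul_eq_mul, mul_div_assoc',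
      div_le_iff₀ (by positivity)]
    nlinarith
  unfold tvAniso
  linarith

end Components

/-- Theorem 1: total variation on lines.  For an open, bounded,
convex `U ⊆ ℝ^d` and `f ∈ BV(U)` (i.e. `f ∈ L¹(U)` with `TV(f; U) < ∞`), the
anisotropic total variation of `f` on `U` equals the sum over coordinate directions
`j` of the integral, over the projection `U_{-j}` of `U`, of the essential variation
of the univariate slice `t ↦ f(·, x_{-j})` on the segment
`I_{x_{-j}} = [a_{x_{-j}}, b_{x_{-j}}]`. -/
theorem tv_on_lines (d : ℕ) (hd : 1 ≤ d) (U : Set (Fin d → ℝ)) (hUopen : IsOpen U)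
    (hUbdd : Bornology.IsBounded U) (hUconv : Convex ℝ U)
    (f : (Fin d → ℝ) → ℝ) (hf : IntegrableOn f U)
    (hBV : BddAbove (tvTestVals d f U)) :
    ENNReal.ofReal (tvAniso d f U) =
      ∑ j : Fin d,
        ∫⁻ w in {w : {l : Fin d // l ≠ j} → ℝ | ∃ t, insertCoord d j t w ∈ U},
          essVar (fun t => f (insertCoord d j t w))
            (Set.Icc (sInf {t | insertCoord d j t w ∈ U})
              (sSup {t | insertCoord d j t w ∈ U})) := by
  set F : (Fin d → ℝ) → ℝ := U.indicator (hf.aestronglyMeasurable.mk f) with hFdef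
  have hUm := hUopen.measurableSet
  have hFm : Measurable F := hf.aestronglyMeasurable.stronglyMeasurable_mk.measurable.indicator hUm
  have hF : Integrable F := by
    rw [hFdef, integrable_indicator_iff hUm]
    exact hf.congr hf.aestronglyMeasurable.ae_eq_mk
  have hfF : f =ᵐ[volume.restrict U] F := by
    filter_upwards [hf.aestronglyMeasurable.ae_eq_mk, ae_restrict_mem hUm] with x h1 h2
    rw [hFdef, indicator_of_mem h2, h1]
  change _ = ∑ j, sliceVar j U f
  simp only [sliceVar_congr _ hUopen hUbdd hUconv hfF]
  apply le_antisymm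
  · have hv : ∀ v ∈ tvTestVals d f U, ENNReal.ofReal v ≤ ∑ j, sliceVar j U F := by
      rintro v ⟨φ, h1, h2, h3, h4, rfl⟩
      have hφ := isTestFun_component h1 h2 h3 h4
      rw [integral_mul_divg_eq hF hfF hφ]
      refine (Finset.le_sum_of_subadditive ENNReal.ofReal ENNReal.ofReal_zero.le
        (fun _ _ => ENNReal.ofReal_add_le) _ _).trans (Finset.sum_le_sum fun j _ => ?_)
      exact ofReal_integral_mul_fderiv_le hUopen hF
        (fun t ht => lintegral_shift_sub_le_sliceVar j hUopen hUbdd hUconv hFm ht) (hφ j)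
    by_cases htop : ∑ j, sliceVar j U F = ⊤
    · rw [htop]; exact le_top
    · refine ENNReal.ofReal_le_of_le_toReal (csSup_le ?_ fun v h => ?_)
      · exact ⟨_, sum_integral_mem_tvTestVals hF hfF fun _ => isTestFun_zero⟩
      · exact (ENNReal.ofReal_le_iff_le_toReal htop).1 (hv v h)
  · have hbdd := bddAbove_partialTestVals hF hfF hBV
    calc ∑ j, sliceVar j U F ≤ ∑ j, ENNReal.ofReal (sSup (partialTestVals U F j)) := by
          refine Finset.sum_le_sum fun j _ =>
            sliceVar_le j hUopen hUbdd hUconv hFm hF fun t ht => ?_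
          rw [← ENNReal.ofReal_mul ht.le]
          exact lintegral_shift_sub_le_of_isTestFun hUopen hUconv hFm hF
            (fun φ hφ => le_csSup (hbdd j) ⟨φ, hφ, rfl⟩) ht
      _ = ENNReal.ofReal (∑ j, sSup (partialTestVals U F j)) :=
          (ENNReal.ofReal_sum_of_nonneg fun j _ =>
            le_csSup (hbdd j) (zero_mem_partialTestVals F j)).symm
      _ ≤ ENNReal.ofReal (tvAniso d f U) :=
          ENNReal.ofReal_le_ofReal (sum_sSup_partialTestVals_le hF hfF hBV)
end
end

section
/- Let k ≥ 0, d ≥ 1 be integers and s = (k+1)/d. Consider data y ∈ ℝ^n with independent coordinates y_i ~ N(θ_{0,i}, σ²), where n = N^d and N > k+1, and let C_n = ‖D_{n,d}^{(k+1)} θ₀‖₁ > 0. For every δ ∈ (0,1) there exist constants c₁, c₂ > 0 depending only on k, d, σ, δ such that the KTF estimator θ̂ = argmin_{θ ∈ ℝ^n} (1/2)‖y − θ‖₂² + λ‖D_{n,d}^{(k+1)} θ‖₁, with tuning parameter λ = c₁ √(log n) when s < 1/2, λ = c₁ log n when s = 1/2, and λ = c₁ (log n)^{1/(2s+1)} (n/C_n)^{(2s−1)/(2s+1)}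 when s > 1/2, satisfies with probability at least 1 − δ: (1/n)‖θ̂ − θ₀‖₂² ≤ c₂ ( 1/n + λ C_n / n ). -/
open scoped BigOperators ENNReal NNReal
open MeasureTheory ProbabilityTheory Matrix

noncomputable section

/-- Product Gaussian measure with coordinatewise means `θ0` and variance `σ^2`. -/
def gaussSeq {ι : Type*} [Fintype ι] (θ0 : ι → ℝ) (σ : ℝ) : Measure (ι → ℝ) :=
  Measure.pi fun i => gaussianReal (θ0 i) (Real.toNNReal (σ ^ 2))

open Polynomial in
lemma coeff_mul_eq_sum_range {p q : ℝ[X]} {M : ℕ} (hM : p.natDegree < M) (n : ℕ) :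
    (p * q).coeff n =
      ∑ i ∈ Finset.range M, p.coeff i * (if i ≤ n then q.coeff (n - i) else 0) := by
  conv_lhs => rw [p.as_sum_range' M hM, Finset.sum_mul, finsetSum_coeff]
  refine Finset.sum_congr rfl fun i _ => ?_
  rw [← C_mul_X_pow_eq_monomial, mul_assoc, coeff_C_mul, coeff_X_pow_mul']

/-- The coefficients of `p` are bounded by `a`, and their absolute sum by `s`. -/
def CoeffBound (p : Polynomial ℝ) (a s : ℝ) : Prop :=
  (∀ n, |p.coeff n| ≤ a) ∧ ∀ T : Finset ℕ, ∑ n ∈ T, |p.coeff n| ≤ s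

namespace CoeffBound

open Polynomial

variable {p q : ℝ[X]} {a s a' s' : ℝ}

lemma nonneg_left (h : CoeffBound p a s) : 0 ≤ a := (abs_nonneg _).trans (h.1 0)

lemma nonneg_right (h : CoeffBound p a s) : 0 ≤ s := by simpa using h.2 ∅

lemma mono (h : CoeffBound p a s) (ha : a ≤ a') (hs : s ≤ s') : CoeffBound p a' s' :=
  ⟨fun n => (h.1 n).trans ha, fun T => (h.2 T).trans hs⟩

lemma neg (h : CoeffBound p a s) : CoeffBound (-p) a s := by
  simpa [CoeffBound] using h

lemma add (hp : CoeffBound p a s) (hq : CoeffBound q a' s') :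
    CoeffBound (p + q) (a + a') (s + s') := by
  refine ⟨fun n => ?_, fun T => ?_⟩
  · rw [coeff_add]
    exact (abs_add_le _ _).trans (add_le_add (hp.1 n) (hq.1 n))
  · calc ∑ n ∈ T, |(p + q).coeff n| ≤ ∑ n ∈ T, (|p.coeff n| + |q.coeff n|) :=
          Finset.sum_le_sum fun n _ => by rw [coeff_add]; exact abs_add_le _ _
      _ ≤ s + s' := by
          rw [Finset.sum_add_distrib]
          exact add_le_add (hp.2 T) (hq.2 T)

lemma sub (hp : CoeffBound p a s) (hq : CoeffBound q a' s') :
    CoeffBound (p - q) (a + a') (s + s') := by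
  rw [sub_eq_add_neg]; exact hp.add hq.neg

lemma mul (hp : CoeffBound p a s) (hq : CoeffBound q a' s') :
    CoeffBound (p * q) (s * a') (s * s') := by
  have key : ∀ n, |(p * q).coeff n| ≤ ∑ i ∈ Finset.range (p.natDegree + 1),
      |p.coeff i| * (if i ≤ n then |q.coeff (n - i)| else 0) := by
    intro n
    rw [coeff_mul_eq_sum_range (Nat.lt_succ_self _) n]
    refine (Finset.abs_sum_le_sum_abs _ _).trans (Finset.sum_le_sum fun i _ => ?_)
    rw [abs_mul]
    split_ifs <;> simp
  refine ⟨fun n => (key n).trans ?_, fun T => ?_⟩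
  · calc _ ≤ ∑ i ∈ Finset.range (p.natDegree + 1), |p.coeff i| * a' := by
          refine Finset.sum_le_sum fun i _ => mul_le_mul_of_nonneg_left ?_ (abs_nonneg _)
          split_ifs
          · exact hq.1 _
          · exact hq.nonneg_left
      _ ≤ s * a' := by
          rw [← Finset.sum_mul]
          exact mul_le_mul_of_nonneg_right (hp.2 _) hq.nonneg_left
  · calc _ ≤ ∑ n ∈ T, ∑ i ∈ Finset.range (p.natDegree + 1),
          |p.coeff i| * (if i ≤ n then |q.coeff (n - i)| else 0) :=
          Finset.sum_le_sum fun n _ => key n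
      _ = ∑ i ∈ Finset.range (p.natDegree + 1),
          |p.coeff i| * ∑ n ∈ T, (if i ≤ n then |q.coeff (n - i)| else 0) := by
          rw [Finset.sum_comm]
          simp_rw [Finset.mul_sum]
      _ ≤ ∑ i ∈ Finset.range (p.natDegree + 1), |p.coeff i| * s' := by
          refine Finset.sum_le_sum fun i _ => mul_le_mul_of_nonneg_left ?_ (abs_nonneg _)
          rw [← Finset.sum_filter]
          calc _ = ∑ m ∈ (T.filter (i ≤ ·)).image (· - i), |q.coeff m| := by
                rw [Finset.sum_image]
                intro x hx y hy hxy
                simp at hx hy hxy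
                omega
            _ ≤ s' := hq.2 _
      _ ≤ s * s' := by
          rw [← Finset.sum_mul]
          exact mul_le_mul_of_nonneg_right (hp.2 _) hq.nonneg_right

lemma of_nonneg (h0 : ∀ n, 0 ≤ p.coeff n) (ha : ∀ n, p.coeff n ≤ a) (hs : p.eval 1 ≤ s) :
    CoeffBound p a s := by
  refine ⟨fun n => by rw [abs_of_nonneg (h0 n)]; exact ha n, fun T => le_trans ?_ hs⟩
  rw [eval_eq_sum_range]
  simp_rw [abs_of_nonneg (h0 _), one_pow, mul_one]
  rw [← Finset.sum_filter_add_sum_filter_not T (· ∈ Finset.range (p.natDegree + 1))]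
  have : ∑ x ∈ T with x ∉ Finset.range (p.natDegree + 1), p.coeff x = 0 := by
    refine Finset.sum_eq_zero fun x hx => ?_
    simp at hx
    exact coeff_eq_zero_of_natDegree_lt (by omega)
  rw [this, add_zero]
  exact Finset.sum_le_sum_of_subset_of_nonneg (fun x hx => (Finset.mem_filter.1 hx).2)
    fun i _ _ => h0 i

lemma pow_succ (hp : CoeffBound p a s) (k : ℕ) :
    CoeffBound (p ^ (k + 1)) (s ^ k * a) (s ^ (k + 1)) := by
  induction k with
  | zero => simpa using hp
  | succ k ih =>
    rw [_root_.pow_succ' p, _root_.pow_succ' s, _root_.pow_succ' s (k + 1), mul_assoc]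
    exact hp.mul ih

end CoeffBound

section Average

open Polynomial

/-- Generating polynomial of the forward moving average over `m` points. -/
def avgPoly (m : ℕ) : ℝ[X] := C (1 / (m : ℝ)) * ∑ i ∈ Finset.range m, X ^ i

/-- The quotient of `1 - avgPoly m` by `1 - X`. -/
def avgQuot (m : ℕ) : ℝ[X] :=
  C (1 / (m : ℝ)) * ∑ i ∈ Finset.range m, ∑ u ∈ Finset.range i, X ^ u

/-- Generating polynomial of a smoothing filter at scale `m` that reproduces polynomials
of degree less than `r`. -/
def filterPoly (r m : ℕ) : ℝ[X] := 1 - (1 - avgPoly m) ^ r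

/-- The quotient of `filterPoly r m - filterPoly r (2 * m)` by `(X - 1) ^ r`. -/
def filterQuot (r m : ℕ) : ℝ[X] := (-1) ^ r * (avgQuot (2 * m) ^ r - avgQuot m ^ r)

lemma one_sub_avgPoly {m : ℕ} (hm : 0 < m) : 1 - avgPoly m = (1 - X) * avgQuot m := by
  have h1 : (1 : ℝ[X]) = C (1 / (m : ℝ)) * ∑ i ∈ Finset.range m, 1 := by
    rw [Finset.sum_const, Finset.card_range, nsmul_eq_mul, mul_one, ← C_eq_natCast, ← C_mul]
    rw [one_div, inv_mul_cancel₀ (by positivity), C_1]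
  have h2 : ∀ i : ℕ, (1 : ℝ[X]) - X ^ i = (1 - X) * ∑ u ∈ Finset.range i, X ^ u := by
    intro i
    have := geom_sum_mul (X : ℝ[X]) i
    linear_combination this
  rw [avgPoly, avgQuot, mul_left_comm, Finset.mul_sum (a := 1 - X),
    ← Finset.sum_congr rfl fun i _ => h2 i, Finset.sum_sub_distrib, mul_sub, ← h1]

lemma filterPoly_sub (r : ℕ) {m : ℕ} (hm : 0 < m) :
    filterPoly r m - filterPoly r (2 * m) = filterQuot r m * (X - 1) ^ r := by
  have h : (X - 1 : ℝ[X]) ^ r = (-1) ^ r * (1 - X) ^ r := by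
    rw [← mul_pow]; ring
  rw [filterPoly, filterPoly, filterQuot, h, one_sub_avgPoly hm,
    one_sub_avgPoly (show 0 < 2 * m by omega), mul_pow, mul_pow]
  have h2 : ((-1 : ℝ[X]) ^ r) * (-1) ^ r = 1 := by rw [← mul_pow]; simp
  linear_combination (-(1 - X) ^ r * (avgQuot (2 * m) ^ r - avgQuot m ^ r)) * h2

lemma filterPoly_one {r : ℕ} (hr : r ≠ 0) : filterPoly r 1 = 1 := by
  simp [filterPoly, avgPoly, hr]

lemma natDegree_avgQuot_le (m : ℕ) : (avgQuot m).natDegree ≤ m - 2 := by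
  refine (natDegree_C_mul_le _ _).trans (natDegree_sum_le_of_forall_le _ _ fun i hi => ?_)
  refine natDegree_sum_le_of_forall_le _ _ fun u hu => ?_
  rw [natDegree_X_pow]
  simp at hi hu
  omega

lemma natDegree_filterQuot_le (r m : ℕ) : (filterQuot r m).natDegree ≤ r * (2 * m - 2) := by
  have h : filterQuot r m = C ((-1) ^ r) * (avgQuot (2 * m) ^ r - avgQuot m ^ r) := by
    simp [filterQuot]
  rw [h]
  refine (natDegree_C_mul_le _ _).trans ((natDegree_sub_le _ _).trans (max_le ?_ ?_))
  · exact natDegree_pow_le.trans (Nat.mul_le_mul_left _ (natDegree_avgQuot_le _))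
  · exact natDegree_pow_le.trans
      (Nat.mul_le_mul_left _ ((natDegree_avgQuot_le _).trans (by omega)))

lemma coeffBound_avgPoly {m : ℕ} (hm : 0 < m) : CoeffBound (avgPoly m) (1 / m) 1 := by
  have hc : ∀ n, (avgPoly m).coeff n = 1 / m * (if n < m then 1 else 0) := by
    intro n
    simp [avgPoly, coeff_X_pow]
  have hm' : (0 : ℝ) < m := by exact_mod_cast hm
  refine CoeffBound.of_nonneg (fun n => ?_) (fun n => ?_) ?_
  · rw [hc]; split_ifs <;> simp
  · rw [hc]; split_ifs <;> simp
  · simp [avgPoly, eval_finsetSum, hm'.ne']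

lemma coeffBound_avgQuot {m : ℕ} (hm : 0 < m) : CoeffBound (avgQuot m) 1 m := by
  have hc : ∀ n, (avgQuot m).coeff n =
      1 / m * ∑ i ∈ Finset.range m, (if n < i then 1 else 0) := by
    intro n
    simp [avgQuot, coeff_X_pow]
  have hm' : (0 : ℝ) < m := by exact_mod_cast hm
  refine CoeffBound.of_nonneg (fun n => ?_) (fun n => ?_) ?_
  · rw [hc]
    refine mul_nonneg (by positivity) (Finset.sum_nonneg fun i _ => ?_)
    split_ifs <;> simp
  · rw [hc, one_div, inv_mul_le_iff₀ hm', mul_one]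
    calc _ ≤ ∑ i ∈ Finset.range m, (1 : ℝ) :=
          Finset.sum_le_sum fun i _ => by split_ifs <;> simp
      _ = m := by simp
  · have : ∑ i ∈ Finset.range m, (i : ℝ) ≤ m * m := by
      calc _ ≤ ∑ i ∈ Finset.range m, (m : ℝ) :=
            Finset.sum_le_sum fun i hi => by
              exact_mod_cast (Finset.mem_range.1 hi).le
        _ = m * m := by simp
    simp only [avgQuot, eval_mul, eval_C, eval_finsetSum, eval_pow, eval_X, one_pow,
      Finset.sum_const, Finset.card_range, nsmul_eq_mul, mul_one]
    rw [one_div, inv_mul_le_iff₀ hm']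
    exact this

lemma coeffBound_filterPoly (r : ℕ) {m : ℕ} (hm : 0 < m) :
    CoeffBound (filterPoly r m) (2 ^ r / m) (2 ^ r) := by
  have hm' : (0 : ℝ) < m := by exact_mod_cast hm
  suffices h : CoeffBound (filterPoly r m) ((2 ^ r - 1) / m) (2 ^ r - 1) by
    refine h.mono ?_ (by linarith)
    gcongr
    linarith
  induction r with
  | zero => simp [filterPoly, CoeffBound]
  | succ r ih =>
    have h : filterPoly (r + 1) m = filterPoly r m + avgPoly m - filterPoly r m * avgPoly m := by
      simp only [filterPoly]; ring
    rw [h]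
    refine ((ih.add (coeffBound_avgPoly hm)).sub (ih.mul (coeffBound_avgPoly hm))).mono ?_ ?_
    · apply le_of_eq; field_simp; ring
    · apply le_of_eq; ring

lemma coeffBound_filterQuot (k : ℕ) {m : ℕ} (hm : 0 < m) :
    CoeffBound (filterQuot (k + 1) m) (2 ^ (k + 2) * m ^ k) (2 ^ (k + 2) * m ^ (k + 1)) := by
  have h1 := (coeffBound_avgQuot (show 0 < 2 * m by omega)).pow_succ k
  have h2 := (coeffBound_avgQuot hm).pow_succ k
  have hm' : (0 : ℝ) < m := by exact_mod_cast hm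
  have h3 : CoeffBound (avgQuot (2 * m) ^ (k + 1) - avgQuot m ^ (k + 1))
      (2 ^ (k + 2) * m ^ k) (2 ^ (k + 2) * m ^ (k + 1)) := by
    have h4 : (1 : ℝ) ≤ 2 ^ k := one_le_pow₀ (by norm_num)
    refine (h1.sub h2).mono ?_ ?_
    · push_cast
      rw [mul_pow, mul_one, mul_one, ← add_one_mul]
      refine mul_le_mul_of_nonneg_right ?_ (by positivity)
      rw [pow_add]; linarith
    · push_cast
      rw [mul_pow, ← add_one_mul]
      refine mul_le_mul_of_nonneg_right ?_ (by positivity)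
      rw [pow_add, pow_add]; linarith
  rw [filterQuot]
  rcases neg_one_pow_eq_or ℝ[X] (k + 1) with h | h <;> rw [h]
  · simpa using h3
  · simpa using h3.neg

end Average

section Univariate

open Polynomial

lemma D1_mul_apply {M : ℕ} {α : Type*} (A : Matrix (Fin M) α ℝ) (i : Fin (M - 1)) (a : α) :
    (D1 M * A) i a = A ⟨i + 1, by omega⟩ a - A ⟨i, by omega⟩ a := by
  have h1 : ∀ j : Fin M, D1 M i j * A j a =
      (if j = ⟨i + 1, by omega⟩ then A j a else 0) -
        (if j = ⟨i, by omega⟩ then A j a else 0) := by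
    intro j
    simp only [D1, Matrix.of_apply, Fin.ext_iff]
    split_ifs <;> first | omega | simp
  rw [Matrix.mul_apply, Finset.sum_congr rfl fun j _ => h1 j, Finset.sum_sub_distrib]
  simp

lemma Dop_apply (N r : ℕ) (t : Fin (N - r)) (y : Fin N) :
    Dop N r t y = if (t : ℕ) ≤ y then ((X - 1 : ℝ[X]) ^ r).coeff (y - t) else 0 := by
  induction r with
  | zero =>
    simp only [Dop, Matrix.of_apply, pow_zero, coeff_one]
    split_ifs <;> first | omega | rfl
  | succ r ih =>
    rw [Dop]
    erw [D1_mul_apply]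
    rw [ih, ih, pow_succ, mul_sub, mul_one]
    simp only [coeff_sub]
    rcases lt_trichotomy (t : ℕ) y with h | h | h
    · obtain ⟨n, hn⟩ := Nat.exists_eq_add_of_lt h
      have e1 : (y : ℕ) - t = n + 1 := by omega
      have e2 : (y : ℕ) - (t + 1) = n := by omega
      rw [if_pos (by omega), if_pos h.le, if_pos h.le, e1, e2, coeff_mul_X]
    · rw [if_neg (by omega), if_pos h.le, if_pos h.le, h, Nat.sub_self, coeff_mul_X_zero]
    · rw [if_neg (by omega), if_neg (by omega), if_neg (by omega), sub_zero]

lemma Dop_rev (N r : ℕ) (t : Fin (N - r)) (y : Fin N) :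
    Dop N r t.rev y.rev = (-1) ^ r * Dop N r t y := by
  have hc : ∀ n, ((X - 1 : ℝ[X]) ^ r).coeff n = (-1) ^ (r - n) * (r.choose n : ℝ) := by
    intro n
    have := coeff_X_add_C_pow (-1 : ℝ) r n
    rwa [C_neg, C_1, ← sub_eq_add_neg] at this
  rw [Dop_apply, Dop_apply, hc, hc]
  simp only [Fin.val_rev]
  have ht := t.isLt
  have hy := y.isLt
  by_cases h1 : (t : ℕ) ≤ y
  · by_cases h2 : (y : ℕ) - t ≤ r
    · rw [if_pos (by omega), if_pos h1]
      obtain ⟨n, hn⟩ := Nat.exists_eq_add_of_le h1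
      have e1 : N - (y + 1) - (N - r - (t + 1)) = r - n := by omega
      have e2 : (y : ℕ) - t = n := by omega
      have e3 : r - (r - n) = n := by omega
      rw [e1, e2, e3, Nat.choose_symm (by omega), ← mul_assoc, ← pow_add]
      congr 1
      rw [show r + (r - n) = 2 * (r - n) + n by omega, pow_add, pow_mul]
      simp
    · rw [if_neg (by omega), if_pos h1, Nat.choose_eq_zero_of_lt (by omega)]
      simp
  · rw [if_neg h1]
    split_ifs
    · rw [Nat.choose_eq_zero_of_lt (by omega)]; simp
    · simp

/-- Weights of the forward-looking filter of order `r` at scale `m`. -/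
def fwdWeight (r m : ℕ) {N : ℕ} (x y : Fin N) : ℝ :=
  if x ≤ y then (filterPoly r m).coeff (y - x : ℕ) else 0

/-- Kernel expressing the difference of the forward-looking filters at scales `m` and `2 * m`
through the differences of order `r`. -/
def fwdKer (r m : ℕ) {N : ℕ} (x : Fin N) (t : Fin (N - r)) : ℝ :=
  if (x : ℕ) ≤ t then (filterQuot r m).coeff (t - x : ℕ) else 0

/-- Weights of the filter which looks forward in the left half of the grid and backward in the
right half. -/
def smoothWeight (r m : ℕ) {N : ℕ} (x y : Fin N) : ℝ :=
  if 2 * (x : ℕ) < N then fwdWeight r m x y else fwdWeight r m x.rev y.rev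

/-- Kernel expressing the difference of the filters `smoothWeight` at scales `m` and `2 * m`
through the differences of order `r`. -/
def smoothKer (r m : ℕ) {N : ℕ} (x : Fin N) (t : Fin (N - r)) : ℝ :=
  if 2 * (x : ℕ) < N then fwdKer r m x t else (-1) ^ r * fwdKer r m x.rev t.rev

lemma smoothWeight_one {r : ℕ} (hr : r ≠ 0) {N : ℕ} (x y : Fin N) :
    smoothWeight r 1 x y = if x = y then 1 else 0 := by
  have h : ∀ x y : Fin N, fwdWeight r 1 x y = if x = y then 1 else 0 := by
    intro x y
    simp only [fwdWeight, filterPoly_one hr, coeff_one, Fin.ext_iff, Fin.le_def]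
    split_ifs <;> first | omega | rfl
  simp [smoothWeight, h]

lemma fwdWeight_sub {r m N : ℕ} (hm : 0 < m) (hN : 4 * (r * m) ≤ N) (x y : Fin N)
    (hx : 2 * (x : ℕ) < N) :
    fwdWeight r m x y - fwdWeight r (2 * m) x y = ∑ t, fwdKer r m x t * Dop N r t y := by
  have e : r * (2 * m - 2) = 2 * (r * m) - 2 * r := by
    rw [Nat.mul_sub]; ring_nf
  have hrm : r ≤ r * m := Nat.le_mul_of_pos_right r hm
  have hxr : (x : ℕ) + (r * (2 * m - 2) + 1) ≤ N - r := by omega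
  obtain ⟨M, hM⟩ := Nat.exists_eq_add_of_le hxr
  have hM' : N - r = x + (r * (2 * m - 2) + 1 + M) := by omega
  have hdeg : (filterQuot r m).natDegree < r * (2 * m - 2) + 1 + M :=
    (natDegree_filterQuot_le r m).trans_lt (by omega)
  have hsum : ∑ t, fwdKer r m x t * Dop N r t y = ∑ t ∈ Finset.range (N - r),
      (if (x : ℕ) ≤ t then (filterQuot r m).coeff (t - x) else 0) *
        (if t ≤ (y : ℕ) then ((X - 1 : ℝ[X]) ^ r).coeff (y - t) else 0) := by
    rw [Finset.sum_range]
    exact Finset.sum_congr rfl fun t _ => by rw [Dop_apply, fwdKer]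
  rw [hsum, hM', Finset.sum_range_add, Finset.sum_eq_zero, zero_add]
  swap
  · intro t ht
    rw [if_neg (by simpa using ht), zero_mul]
  simp only [fwdWeight]
  by_cases hxy : x ≤ y
  · rw [if_pos hxy, if_pos hxy, ← coeff_sub, filterPoly_sub r hm, coeff_mul_eq_sum_range hdeg]
    refine Finset.sum_congr rfl fun i _ => ?_
    have hxy' : (x : ℕ) ≤ y := hxy
    rw [if_pos (Nat.le_add_right _ _), Nat.add_sub_cancel_left, Nat.sub_add_eq]
    congr 1
    by_cases hi : (x : ℕ) + i ≤ y
    · rw [if_pos hi, if_pos (by omega)]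
    · rw [if_neg hi, if_neg (by omega)]
  · have hxy' : ¬ (x : ℕ) ≤ y := hxy
    rw [if_neg hxy, if_neg hxy, sub_zero, Finset.sum_eq_zero]
    intro i _
    rw [if_neg (show ¬ (x : ℕ) + i ≤ y by omega), mul_zero]

lemma smoothWeight_sub {r m N : ℕ} (hm : 0 < m) (hN : 4 * (r * m) ≤ N) (x y : Fin N) :
    smoothWeight r m x y - smoothWeight r (2 * m) x y =
      ∑ t, smoothKer r m x t * Dop N r t y := by
  by_cases hx : 2 * (x : ℕ) < N
  · simp only [smoothWeight, smoothKer, if_pos hx]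
    exact fwdWeight_sub hm hN x y hx
  · simp only [smoothWeight, smoothKer, if_neg hx]
    rw [fwdWeight_sub hm hN x.rev y.rev (by rw [Fin.val_rev]; omega),
      ← Equiv.sum_comp Fin.revPerm]
    refine Finset.sum_congr rfl fun t _ => ?_
    rw [Fin.revPerm_apply, Dop_rev]
    ring

lemma abs_smoothWeight_le (r : ℕ) {m N : ℕ} (hm : 0 < m) (x y : Fin N) :
    |smoothWeight r m x y| ≤ 2 ^ r / m := by
  have h := coeffBound_filterPoly r hm
  have h' : ∀ x y : Fin N, |fwdWeight r m x y| ≤ 2 ^ r / m := by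
    intro x y
    rw [fwdWeight]
    split_ifs
    · exact h.1 _
    · simpa using h.nonneg_left
  rw [smoothWeight]
  split_ifs <;> exact h' _ _

lemma abs_smoothKer_le (k : ℕ) {m N : ℕ} (hm : 0 < m) (x : Fin N) (t : Fin (N - (k + 1))) :
    |smoothKer (k + 1) m x t| ≤ 2 ^ (k + 2) * m ^ k := by
  have h := coeffBound_filterQuot k hm
  have h' : ∀ (x : Fin N) (t : Fin (N - (k + 1))),
      |fwdKer (k + 1) m x t| ≤ 2 ^ (k + 2) * m ^ k := by
    intro x t
    rw [fwdKer]
    split_ifs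
    · exact h.1 _
    · simpa only [abs_zero] using h.nonneg_left
  rw [smoothKer]
  split_ifs
  · exact h' _ _
  · rw [abs_mul, abs_pow, abs_neg, abs_one, one_pow, one_mul]
    exact h' _ _

lemma CoeffBound.sum_shift_le {p : ℝ[X]} {a s : ℝ} (h : CoeffBound p a s) {N : ℕ} (c : ℕ) :
    ∑ x : Fin N, |if (x : ℕ) ≤ c then p.coeff (c - x) else 0| ≤ s := by
  calc _ = ∑ x ∈ (Finset.univ.filter fun x : Fin N => (x : ℕ) ≤ c), |p.coeff (c - x)| := by
        rw [Finset.sum_filter]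
        exact Finset.sum_congr rfl fun x _ => by split_ifs <;> simp
    _ = ∑ n ∈ (Finset.univ.filter fun x : Fin N => (x : ℕ) ≤ c).image
          (fun x : Fin N => c - (x : ℕ)), |p.coeff n| := by
        rw [Finset.sum_image]
        intro x hx y hy hxy
        simp at hx hy hxy
        ext
        omega
    _ ≤ s := h.2 _

lemma sum_abs_smoothWeight_le (r : ℕ) {m N : ℕ} (hm : 0 < m) (y : Fin N) :
    ∑ x, |smoothWeight r m x y| ≤ 2 ^ (r + 1) := by
  have h := coeffBound_filterPoly r hm
  have h' : ∀ y : Fin N, ∑ x, |fwdWeight r m x y| ≤ 2 ^ r := fun y =>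
    h.sum_shift_le (N := N) (y : ℕ)
  calc _ ≤ ∑ x, (|fwdWeight r m x y| + |fwdWeight r m x.rev y.rev|) := by
        refine Finset.sum_le_sum fun x _ => ?_
        rw [smoothWeight]
        split_ifs
        · exact le_add_of_nonneg_right (abs_nonneg _)
        · exact le_add_of_nonneg_left (abs_nonneg _)
    _ = ∑ x, |fwdWeight r m x y| + ∑ x, |fwdWeight r m x y.rev| := by
        rw [Finset.sum_add_distrib]
        congr 1
        exact Equiv.sum_comp Fin.revPerm fun x => |fwdWeight r m x y.rev|
    _ ≤ 2 ^ r + 2 ^ r := add_le_add (h' _) (h' _)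
    _ = 2 ^ (r + 1) := by ring

lemma sum_abs_smoothKer_le (k : ℕ) {m N : ℕ} (hm : 0 < m) (t : Fin (N - (k + 1))) :
    ∑ x : Fin N, |smoothKer (k + 1) m x t| ≤ 2 ^ (k + 3) * m ^ (k + 1) := by
  have h := coeffBound_filterQuot k hm
  have h' : ∀ t : Fin (N - (k + 1)),
      ∑ x : Fin N, |fwdKer (k + 1) m x t| ≤ 2 ^ (k + 2) * m ^ (k + 1) := fun t =>
    h.sum_shift_le (N := N) (t : ℕ)
  calc _ ≤ ∑ x : Fin N, (|fwdKer (k + 1) m x t| + |fwdKer (k + 1) m x.rev t.rev|) := by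
        refine Finset.sum_le_sum fun x _ => ?_
        rw [smoothKer]
        split_ifs
        · exact le_add_of_nonneg_right (abs_nonneg _)
        · rw [abs_mul, abs_pow, abs_neg, abs_one, one_pow, one_mul]
          exact le_add_of_nonneg_left (abs_nonneg _)
    _ = ∑ x : Fin N, |fwdKer (k + 1) m x t| + ∑ x : Fin N, |fwdKer (k + 1) m x t.rev| := by
        rw [Finset.sum_add_distrib]
        congr 1
        exact Equiv.sum_comp Fin.revPerm fun x => |fwdKer (k + 1) m x t.rev|
    _ ≤ 2 ^ (k + 2) * m ^ (k + 1) + 2 ^ (k + 2) * m ^ (k + 1) := add_le_add (h' _) (h' _)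
    _ = 2 ^ (k + 3) * m ^ (k + 1) := by ring

end Univariate

section Multivariate

variable {d N : ℕ}

/-- Tensor product of the filters `smoothWeight`, as an operator on lattice functions. -/
def smoothMat (r m : ℕ) : Matrix (Fin d → Fin N) (Fin d → Fin N) ℝ :=
  Matrix.of fun x y => ∏ i, smoothWeight r m (x i) (y i)

/-- Kernel expressing `smoothMat r m - smoothMat r (2 * m)` through the KTF penalty matrix. -/
def kerMat (r m : ℕ) : Matrix (Fin d → Fin N) (KtfIdx N d r) ℝ :=
  Matrix.of fun x p => smoothKer r m (x p.1) p.2.1 *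
    ∏ l : {l : Fin d // l ≠ p.1},
      smoothWeight r (if l.1 < p.1 then 2 * m else m) (x l.1) (p.2.2 l)

/-- Kernel expressing `1 - smoothMat r (2 ^ L)` through the KTF penalty matrix. -/
def telescopeMat (r L : ℕ) : Matrix (Fin d → Fin N) (KtfIdx N d r) ℝ :=
  ∑ l ∈ Finset.range L, kerMat r (2 ^ l)

lemma smoothMat_one {r : ℕ} (hr : r ≠ 0) :
    (smoothMat r 1 : Matrix (Fin d → Fin N) (Fin d → Fin N) ℝ) = 1 := by
  ext x y
  rw [smoothMat, Matrix.of_apply, Matrix.one_apply]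
  simp_rw [smoothWeight_one hr]
  rw [Finset.prod_ite_zero]
  simp [funext_iff]

lemma prod_sub_prod_eq_sum (a b : Fin d → ℝ) :
    ∏ i, a i - ∏ i, b i =
      ∑ j, (a j - b j) * ∏ l : {l : Fin d // l ≠ j}, if l.1 < j then b l.1 else a l.1 := by
  have h := Finset.prod_sub_ordered Finset.univ a fun i => a i - b i
  simp only [sub_sub_cancel] at h
  rw [h, sub_sub_cancel]
  refine Finset.sum_congr rfl fun j _ => ?_
  rw [mul_assoc]
  congr 1
  have h2 := Fintype.prod_eq_mul_prod_subtype_ne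
    (fun l : Fin d => if l < j then b l else if j < l then a l else 1) j
  simp only [lt_irrefl, if_false, one_mul] at h2
  calc _ = ∏ l, (if l < j then b l else if j < l then a l else 1) := by
        rw [Finset.prod_filter, Finset.prod_filter, ← Finset.prod_mul_distrib]
        refine Finset.prod_congr rfl fun l _ => ?_
        rcases lt_trichotomy l j with h | h | h
        · simp [h, h.not_gt]
        · simp [h]
        · simp [h, h.not_gt]
    _ = _ := by
        rw [h2]
        refine Finset.prod_congr rfl fun l _ => ?_
        rcases lt_or_gt_of_ne l.2 with h | h
        · simp [h]
        · simp [h, h.not_gt]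

lemma smoothMat_sub {r m : ℕ} (hm : 0 < m) (hN : 4 * (r * m) ≤ N) :
    (smoothMat r m - smoothMat r (2 * m) : Matrix (Fin d → Fin N) (Fin d → Fin N) ℝ) =
      (kerMat r m : Matrix (Fin d → Fin N) (KtfIdx N d r) ℝ) * ktfMat N d r := by
  ext x y
  rw [Matrix.sub_apply, smoothMat, smoothMat, Matrix.of_apply, Matrix.of_apply,
    prod_sub_prod_eq_sum, Matrix.mul_apply, Fintype.sum_sigma]
  refine Finset.sum_congr rfl fun j _ => ?_
  rw [smoothWeight_sub hm hN, Fintype.sum_prod_type, Finset.sum_mul]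
  refine Finset.sum_congr rfl fun t _ => ?_
  rw [Finset.sum_eq_single fun l : {l : Fin d // l ≠ j} => y l.1]
  · simp only [kerMat, ktfMat, Matrix.of_apply]
    simp only [if_true, Finset.prod_const_one, mul_one]
    rw [mul_right_comm]
    congr 1
    congr 1
    exact Finset.prod_congr rfl fun l _ => by split_ifs <;> rfl
  · intro z _ hz
    obtain ⟨l, hl⟩ := Function.ne_iff.1 hz
    simp only [kerMat, ktfMat, Matrix.of_apply]
    have h0 : ∏ l : {l : Fin d // l ≠ j}, (if z l = y l.1 then (1 : ℝ) else 0) = 0 :=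
      Finset.prod_eq_zero (Finset.mem_univ l) (if_neg hl)
    rw [h0, mul_zero, mul_zero]
  · simp

lemma one_sub_smoothMat {r : ℕ} (hr : r ≠ 0) (L : ℕ) (hN : L = 0 ∨ 2 * (r * 2 ^ L) ≤ N) :
    (1 - smoothMat r (2 ^ L) : Matrix (Fin d → Fin N) (Fin d → Fin N) ℝ) =
      (telescopeMat r L : Matrix (Fin d → Fin N) (KtfIdx N d r) ℝ) * ktfMat N d r := by
  rw [telescopeMat, Matrix.sum_mul]
  have h := Finset.sum_range_sub'
    (fun l => (smoothMat r (2 ^ l) : Matrix (Fin d → Fin N) (Fin d → Fin N) ℝ)) L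
  rw [pow_zero, smoothMat_one hr] at h
  rw [← h]
  refine Finset.sum_congr rfl fun l hl => ?_
  have hl' := Finset.mem_range.1 hl
  rw [pow_succ', smoothMat_sub (by positivity)]
  rcases hN with hN | hN
  · omega
  · refine le_trans ?_ hN
    have : 2 ^ (l + 1) ≤ 2 ^ L := Nat.pow_le_pow_right (by norm_num) hl'
    calc 4 * (r * 2 ^ l) = 2 * (r * 2 ^ (l + 1)) := by ring
      _ ≤ 2 * (r * 2 ^ L) := by gcongr

lemma sum_sq_smoothMat_le (r : ℕ) {m : ℕ} (hm : 0 < m) :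
    ∑ y, ∑ x, (smoothMat r m : Matrix (Fin d → Fin N) (Fin d → Fin N) ℝ) x y ^ 2 ≤
      (2 ^ (r + 1)) ^ d * (2 ^ r / m) ^ d * (N ^ d : ℕ) := by
  have hsup : ∀ x y, |(smoothMat r m : Matrix (Fin d → Fin N) (Fin d → Fin N) ℝ) x y| ≤
      (2 ^ r / m) ^ d := by
    intro x y
    rw [smoothMat, Matrix.of_apply, Finset.abs_prod]
    calc _ ≤ ∏ _i : Fin d, (2 ^ r / m : ℝ) :=
          Finset.prod_le_prod (fun _ _ => abs_nonneg _) fun _ _ => abs_smoothWeight_le r hm _ _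
      _ = _ := by rw [Finset.prod_const, Finset.card_univ, Fintype.card_fin]
  have hcol : ∀ y, ∑ x, |(smoothMat r m : Matrix (Fin d → Fin N) (Fin d → Fin N) ℝ) x y| ≤
      (2 ^ (r + 1)) ^ d := by
    intro y
    simp_rw [smoothMat, Matrix.of_apply, Finset.abs_prod]
    calc _ = ∏ i, ∑ u : Fin N, |smoothWeight r m u (y i)| := by
          rw [Finset.prod_univ_sum, Fintype.piFinset_univ]
      _ ≤ ∏ _i : Fin d, (2 ^ (r + 1) : ℝ) :=
          Finset.prod_le_prod (fun _ _ => Finset.sum_nonneg fun _ _ => abs_nonneg _)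
            fun _ _ => sum_abs_smoothWeight_le r hm _
      _ = _ := by simp
  calc _ ≤ ∑ _y : Fin d → Fin N, ((2 ^ (r + 1)) ^ d * (2 ^ r / m) ^ d : ℝ) := by
        refine Finset.sum_le_sum fun y _ => ?_
        calc _ ≤ ∑ x, |(smoothMat r m : Matrix (Fin d → Fin N) (Fin d → Fin N) ℝ) x y| *
              (2 ^ r / m) ^ d := by
              refine Finset.sum_le_sum fun x _ => ?_
              rw [← sq_abs, sq]
              exact mul_le_mul_of_nonneg_left (hsup x y) (abs_nonneg _)
          _ ≤ _ := by
              rw [← Finset.sum_mul]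
              exact mul_le_mul_of_nonneg_right (hcol y) (by positivity)
    _ = _ := by
        rw [Finset.sum_const, nsmul_eq_mul, mul_comm]
        simp

lemma abs_kerMat_le (k : ℕ) {m : ℕ} (hm : 0 < m) (x : Fin d → Fin N)
    (p : KtfIdx N d (k + 1)) :
    |kerMat (k + 1) m x p| ≤ (2 ^ (k + 3)) ^ d * ((m : ℝ) ^ k / (m : ℝ) ^ (d - 1)) := by
  obtain ⟨j, t, z⟩ := p
  have hm' : (0 : ℝ) < m := by exact_mod_cast hm
  have hd : d = d - 1 + 1 := by have := j.pos; omega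
  have hcard : Fintype.card {l : Fin d // l ≠ j} = d - 1 := by simp
  simp only [kerMat, Matrix.of_apply]
  rw [abs_mul, Finset.abs_prod]
  calc _ ≤ (2 ^ (k + 3) * (m : ℝ) ^ k) *
        ∏ _l : {l : Fin d // l ≠ j}, (2 ^ (k + 3) / m : ℝ) := by
        refine mul_le_mul ((abs_smoothKer_le k hm _ _).trans ?_)
          (Finset.prod_le_prod (fun _ _ => abs_nonneg _) fun l _ => ?_)
          (Finset.prod_nonneg fun _ _ => abs_nonneg _) (by positivity)
        · gcongr <;> norm_num
        · have h1 : (0 : ℝ) < m := hm'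
          split_ifs
          · refine (abs_smoothWeight_le (k + 1) (show 0 < 2 * m by omega) _ _).trans ?_
            push_cast
            gcongr
            · norm_num
            · omega
            · linarith
          · refine (abs_smoothWeight_le (k + 1) hm _ _).trans ?_
            gcongr
            · norm_num
            · omega
    _ = (2 ^ (k + 3)) ^ d * ((m : ℝ) ^ k / (m : ℝ) ^ (d - 1)) := by
        rw [Finset.prod_const, Finset.card_univ, hcard]
        conv_rhs => rw [show ((2 : ℝ) ^ (k + 3)) ^ d = (2 ^ (k + 3)) ^ (d - 1 + 1) by rw [← hd]]
        rw [div_pow, pow_succ]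
        ring

lemma sum_abs_kerMat_le (k : ℕ) {m : ℕ} (hm : 0 < m) (p : KtfIdx N d (k + 1)) :
    ∑ x : Fin d → Fin N, |kerMat (k + 1) m x p| ≤
      (2 ^ (k + 3)) ^ d * (m : ℝ) ^ (k + 1) := by
  obtain ⟨j, t, z⟩ := p
  have hm' : (0 : ℝ) < m := by exact_mod_cast hm
  have hd : d = d - 1 + 1 := by have := j.pos; omega
  have hcard : Fintype.card {l : Fin d // l ≠ j} = d - 1 := by simp
  let g : Fin d → Fin N → ℝ := fun i u =>
    if h : i ≠ j then |smoothWeight (k + 1) (if i < j then 2 * m else m) u (z ⟨i, h⟩)|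
    else |smoothKer (k + 1) m u t|
  have hgj : g j = fun u => |smoothKer (k + 1) m u t| := by
    funext u; simp [g]
  have hgl : ∀ l : {l : Fin d // l ≠ j}, g l.1 = fun u =>
      |smoothWeight (k + 1) (if l.1 < j then 2 * m else m) u (z l)| := by
    intro l; funext u; simp [g, l.2]
  have h1 : ∀ x : Fin d → Fin N, |kerMat (k + 1) m x ⟨j, t, z⟩| = ∏ i, g i (x i) := by
    intro x
    rw [Fintype.prod_eq_mul_prod_subtype_ne _ j]
    simp only [kerMat, Matrix.of_apply]
    rw [abs_mul, Finset.abs_prod, hgj]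
    congr 1
    exact Finset.prod_congr rfl fun l _ => by rw [hgl l]
  simp_rw [h1]
  calc _ = ∏ i, ∑ u : Fin N, g i u := by
        rw [Finset.prod_univ_sum, Fintype.piFinset_univ]
    _ = (∑ u : Fin N, g j u) * ∏ l : {l : Fin d // l ≠ j}, ∑ u : Fin N, g l.1 u :=
        Fintype.prod_eq_mul_prod_subtype_ne _ j
    _ ≤ (2 ^ (k + 3) * (m : ℝ) ^ (k + 1)) *
        ∏ _l : {l : Fin d // l ≠ j}, (2 ^ (k + 3) : ℝ) := by
        refine mul_le_mul ?_ (Finset.prod_le_prod (fun l _ => ?_) fun l _ => ?_)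
          (Finset.prod_nonneg fun l _ => ?_) (by positivity)
        · rw [hgj]; exact sum_abs_smoothKer_le k hm t
        · rw [hgl]; exact Finset.sum_nonneg fun _ _ => abs_nonneg _
        · rw [hgl]
          refine (sum_abs_smoothWeight_le (k + 1) (by split_ifs <;> omega) _).trans ?_
          exact pow_le_pow_right₀ (by norm_num) (by omega)
        · rw [hgl]; exact Finset.sum_nonneg fun _ _ => abs_nonneg _
    _ = (2 ^ (k + 3)) ^ d * (m : ℝ) ^ (k + 1) := by
        rw [Finset.prod_const, Finset.card_univ, hcard]
        conv_rhs => rw [show ((2 : ℝ) ^ (k + 3)) ^ d = (2 ^ (k + 3)) ^ (d - 1 + 1) by rw [← hd]]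
        rw [pow_succ _ (d - 1)]
        ring

lemma sum_abs_telescopeMat_le (k L : ℕ) (p : KtfIdx N d (k + 1)) :
    ∑ x : Fin d → Fin N, |telescopeMat (k + 1) L x p| ≤
      (2 ^ (k + 3)) ^ d * ((2 : ℝ) ^ L) ^ (k + 1) := by
  induction L with
  | zero => simp [telescopeMat]
  | succ L ih =>
    rw [telescopeMat, Finset.sum_range_succ, ← telescopeMat]
    calc _ ≤ ∑ x : Fin d → Fin N,
          (|telescopeMat (k + 1) L x p| + |kerMat (k + 1) (2 ^ L) x p|) :=
          Finset.sum_le_sum fun x _ => abs_add_le _ _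
      _ ≤ (2 ^ (k + 3)) ^ d * ((2 : ℝ) ^ L) ^ (k + 1) +
          (2 ^ (k + 3)) ^ d * ((2 : ℝ) ^ L) ^ (k + 1) := by
          rw [Finset.sum_add_distrib]
          refine add_le_add ih ?_
          have := sum_abs_kerMat_le k (m := 2 ^ L) (by positivity) p
          push_cast at this
          exact this
      _ ≤ _ := by
          rw [← two_mul, mul_left_comm]
          gcongr
          rw [pow_succ 2 L, mul_pow, mul_comm]
          gcongr
          exact le_self_pow₀ (by norm_num) (by omega)

lemma sum_sq_telescopeMat_le (k L : ℕ) (p : KtfIdx N d (k + 1)) :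
    ∑ x : Fin d → Fin N, telescopeMat (k + 1) L x p ^ 2 ≤
      3 * ((2 ^ (k + 3)) ^ d) ^ 2 *
        ∑ l ∈ Finset.range L, ((2 : ℝ) ^ (2 * (k + 1)) / 2 ^ d) ^ l := by
  have hd : d = d - 1 + 1 := by have := p.1.pos; omega
  induction L with
  | zero => simp [telescopeMat]
  | succ L ih =>
    rw [telescopeMat, Finset.sum_range_succ, ← telescopeMat, Finset.sum_range_succ, mul_add]
    set K : ℝ := (2 ^ (k + 3)) ^ d with hK
    set α : ℝ := ((2 : ℝ) ^ L) ^ k / ((2 : ℝ) ^ L) ^ (d - 1) with hα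
    set β : ℝ := ((2 : ℝ) ^ L) ^ (k + 1) with hβ
    have hsup : ∀ x : Fin d → Fin N, |kerMat (k + 1) (2 ^ L) x p| ≤ K * α := by
      intro x
      have := abs_kerMat_le k (m := 2 ^ L) (by positivity) x p
      push_cast at this
      exact this
    have hcol : ∑ x : Fin d → Fin N, |kerMat (k + 1) (2 ^ L) x p| ≤ K * β := by
      have := sum_abs_kerMat_le k (m := 2 ^ L) (by positivity) p
      push_cast at this
      exact this
    have hαβ : ((2 : ℝ) ^ (2 * (k + 1)) / 2 ^ d) ^ L = α * β := by
      rw [hα, hβ]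
      conv_lhs => rw [show (2 : ℝ) ^ d = 2 ^ (d - 1 + 1) by rw [← hd]]
      rw [div_pow, pow_right_comm, pow_right_comm 2 (d - 1 + 1), pow_succ _ (d - 1)]
      field_simp
      ring
    have hKα : 0 ≤ K * α := by positivity
    calc _ ≤ ∑ x : Fin d → Fin N, (telescopeMat (k + 1) L x p ^ 2 +
          2 * (K * α) * |telescopeMat (k + 1) L x p| +
          K * α * |kerMat (k + 1) (2 ^ L) x p|) := by
          refine Finset.sum_le_sum fun x _ => ?_
          rw [Matrix.add_apply]
          set a := telescopeMat (k + 1) L x p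
          set b := kerMat (k + 1) (2 ^ L) x p
          have h1 : a * b ≤ |a| * (K * α) := (le_abs_self _).trans
            (by rw [abs_mul]; exact mul_le_mul_of_nonneg_left (hsup x) (abs_nonneg _))
          have h2 : b ^ 2 ≤ K * α * |b| := by
            rw [← sq_abs, sq]
            exact mul_le_mul_of_nonneg_right (hsup x) (abs_nonneg _)
          nlinarith
      _ ≤ _ := by
          rw [Finset.sum_add_distrib, Finset.sum_add_distrib, ← Finset.mul_sum, ← Finset.mul_sum,
            hαβ]
          have h3 := mul_le_mul_of_nonneg_left (sum_abs_telescopeMat_le k L p)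
            (show 0 ≤ 2 * (K * α) by positivity)
          have h4 := mul_le_mul_of_nonneg_left hcol hKα
          nlinarith

end Multivariate

section Probability

variable {ι : Type*} [Fintype ι] (θ0 : ι → ℝ) (σ : ℝ)

instance : IsProbabilityMeasure (gaussSeq θ0 σ) := by
  unfold gaussSeq; infer_instance

lemma gaussSeq_map_noise (i : ι) :
    (gaussSeq θ0 σ).map (fun y => y i - θ0 i) = gaussianReal 0 (σ ^ 2).toNNReal := by
  have h := (measurePreserving_eval (fun i => gaussianReal (θ0 i) (σ ^ 2).toNNReal) i).map_eq
  have h2 := gaussianReal_map_sub_const (μ := θ0 i) (v := (σ ^ 2).toNNReal) (θ0 i)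
  rw [sub_self, ← h, Measure.map_map (by fun_prop) (by fun_prop)] at h2
  exact h2

lemma iIndepFun_noise :
    iIndepFun (fun (i : ι) (y : ι → ℝ) => y i - θ0 i) (gaussSeq θ0 σ) :=
  iIndepFun_pi (X := fun i u => u - θ0 i) fun i => by fun_prop

lemma hasSubgaussianMGF_noise (i : ι) :
    HasSubgaussianMGF (fun y => y i - θ0 i) (σ ^ 2).toNNReal (gaussSeq θ0 σ) where
  integrable_exp_mul t := by
    have h := integrable_exp_mul_gaussianReal (μ := 0) (v := (σ ^ 2).toNNReal) t
    rw [← gaussSeq_map_noise θ0 σ i] at h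
    exact h.comp_measurable (by fun_prop)
  mgf_le t := by
    rw [mgf_gaussianReal (gaussSeq_map_noise θ0 σ i)]
    simp

lemma integral_noise (i : ι) : ∫ y, (y i - θ0 i) ∂gaussSeq θ0 σ = 0 := by
  have h := integral_id_gaussianReal (μ := 0) (v := (σ ^ 2).toNNReal)
  rw [← gaussSeq_map_noise θ0 σ i, integral_map (Measurable.aemeasurable (by fun_prop))
    (by fun_prop)] at h
  exact h

lemma variance_noise (i : ι) : Var[fun y => y i - θ0 i; gaussSeq θ0 σ] = σ ^ 2 := by
  have h := variance_fun_id_gaussianReal (μ := 0) (v := (σ ^ 2).toNNReal)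
  rw [← gaussSeq_map_noise θ0 σ i, variance_map (by fun_prop)
    (Measurable.aemeasurable (by fun_prop))] at h
  rw [Real.coe_toNNReal _ (sq_nonneg σ)] at h
  exact h

lemma hasSubgaussianMGF_sum (a : ι → ℝ) :
    HasSubgaussianMGF (fun y => ∑ i, a i * (y i - θ0 i))
      (∑ i, (a i ^ 2).toNNReal * (σ ^ 2).toNNReal) (gaussSeq θ0 σ) := by
  refine HasSubgaussianMGF.sum_of_iIndepFun
    (X := fun (i : ι) (y : ι → ℝ) => a i * (y i - θ0 i)) ?_ fun i _ => ?_
  swap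
  · rw [Real.toNNReal_of_nonneg (sq_nonneg (a i))]
    exact (hasSubgaussianMGF_noise θ0 σ i).const_mul (a i)
  exact (iIndepFun_noise θ0 σ).comp (fun i u => a i * u) fun i => by fun_prop

lemma measureReal_abs_sum_ge_le (a : ι → ℝ) {c t : ℝ} (hc : 0 < c)
    (ha : σ ^ 2 * ∑ i, a i ^ 2 ≤ c) (ht : 0 ≤ t) :
    (gaussSeq θ0 σ).real {y | t ≤ |∑ i, a i * (y i - θ0 i)|} ≤
      2 * Real.exp (-t ^ 2 / (2 * c)) := by
  have h0 := hasSubgaussianMGF_sum θ0 σ a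
  have h : HasSubgaussianMGF (fun y => ∑ i, a i * (y i - θ0 i)) c.toNNReal (gaussSeq θ0 σ) := by
    refine ⟨h0.integrable_exp_mul, fun u => (h0.mgf_le u).trans ?_⟩
    rw [Real.exp_le_exp]
    have hle : ((∑ i, (a i ^ 2).toNNReal * (σ ^ 2).toNNReal : ℝ≥0) : ℝ) ≤ c.toNNReal := by
      rw [Real.coe_toNNReal _ hc.le]
      refine le_trans (le_of_eq ?_) ha
      push_cast
      simp_rw [Real.coe_toNNReal _ (sq_nonneg _)]
      rw [← Finset.sum_mul, mul_comm]
    gcongr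
  have h1 := h.measure_ge_le ht
  have h2 := h.neg.measure_ge_le ht
  rw [Real.coe_toNNReal _ hc.le] at h1 h2
  have hsub : {y : ι → ℝ | t ≤ |∑ i, a i * (y i - θ0 i)|} ⊆
      {y | t ≤ ∑ i, a i * (y i - θ0 i)} ∪
        {y | t ≤ (-fun y : ι → ℝ => ∑ i, a i * (y i - θ0 i)) y} := by
    intro y hy
    exact (le_abs (a := t)).1 hy
  calc _ ≤ _ := measureReal_mono hsub
    _ ≤ _ := measureReal_union_le _ _
    _ ≤ _ := by rw [two_mul]; exact add_le_add h1 h2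

lemma integral_sum_sq (a : ι → ℝ) :
    ∫ y, (∑ i, a i * (y i - θ0 i)) ^ 2 ∂gaussSeq θ0 σ = σ ^ 2 * ∑ i, a i ^ 2 := by
  have hsub := fun i => (hasSubgaussianMGF_noise θ0 σ i).const_mul (a i)
  have h0 : ∫ y, (∑ i, a i * (y i - θ0 i)) ∂gaussSeq θ0 σ = 0 := by
    rw [integral_finsetSum _ fun i _ => (hsub i).integrable]
    refine Finset.sum_eq_zero fun i _ => ?_
    rw [integral_const_mul, integral_noise, mul_zero]
  rw [← variance_of_integral_eq_zero (hasSubgaussianMGF_sum θ0 σ a).aemeasurable h0]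
  have h1 := IndepFun.variance_sum (μ := gaussSeq θ0 σ) (s := Finset.univ)
    (X := fun (i : ι) y => a i * (y i - θ0 i)) (fun i _ => (hsub i).memLp 2)
    (fun i _ j _ hij => ((iIndepFun_noise θ0 σ).comp (fun i u => a i * u)
      fun i => by fun_prop).indepFun hij)
  have h2 : (∑ i, fun y : ι → ℝ => a i * (y i - θ0 i)) =
      fun y => ∑ i, a i * (y i - θ0 i) := by
    ext y; simp
  rw [h2] at h1
  rw [h1, Finset.mul_sum]
  refine Finset.sum_congr rfl fun i _ => ?_
  rw [variance_const_mul, variance_noise, mul_comm]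

lemma measureReal_sum_sq_ge_le {κ : Type*} [Fintype κ] (A : Matrix ι κ ℝ) {B δ : ℝ}
    (hB : 0 < B) (hδ : 0 < δ) (hA : σ ^ 2 * ∑ j, ∑ i, A i j ^ 2 ≤ B) :
    (gaussSeq θ0 σ).real {y | B / δ ≤ ∑ j, (∑ i, A i j * (y i - θ0 i)) ^ 2} ≤ δ := by
  have hint : ∀ j, Integrable (fun y => (∑ i, A i j * (y i - θ0 i)) ^ 2) (gaussSeq θ0 σ) :=
    fun j => ((hasSubgaussianMGF_sum θ0 σ fun i => A i j).memLp 2).integrable_sq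
  have h := mul_meas_ge_le_integral_of_nonneg (μ := gaussSeq θ0 σ)
    (f := fun y => ∑ j, (∑ i, A i j * (y i - θ0 i)) ^ 2)
    (Filter.Eventually.of_forall fun y => Finset.sum_nonneg fun j _ => sq_nonneg _)
    (integrable_finsetSum _ fun j _ => hint j) (B / δ)
  rw [integral_finsetSum _ fun j _ => hint j] at h
  simp_rw [integral_sum_sq] at h
  rw [← Finset.mul_sum] at h
  have h3 := h.trans hA
  rw [div_mul_eq_mul_div, div_le_iff₀ hδ] at h3
  exact le_of_mul_le_mul_left h3 hB

lemma ofReal_le_gaussSeq_good {κ κ' : Type*} [Fintype κ] [Fintype κ'] (A : Matrix ι κ ℝ)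
    (R : Matrix ι κ' ℝ) {B c lam δ : ℝ} (hB : 0 < B) (hc : 0 < c) (hδ : 0 < δ)
    (hlam : 0 ≤ lam) (hA : σ ^ 2 * ∑ j, ∑ i, A i j ^ 2 ≤ B)
    (hR : ∀ p, σ ^ 2 * ∑ i, R i p ^ 2 ≤ c)
    (htail : Fintype.card κ' * (2 * Real.exp (-lam ^ 2 / (2 * c))) ≤ δ / 2) :
    ENNReal.ofReal (1 - δ) ≤ gaussSeq θ0 σ
      {y | ∑ j, (∑ i, A i j * (y i - θ0 i)) ^ 2 ≤ 2 * B / δ ∧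
        ∀ p, |∑ i, R i p * (y i - θ0 i)| ≤ lam} := by
  set G := {y : ι → ℝ | ∑ j, (∑ i, A i j * (y i - θ0 i)) ^ 2 ≤ 2 * B / δ ∧
        ∀ p, |∑ i, R i p * (y i - θ0 i)| ≤ lam} with hG
  have hGm : MeasurableSet G := by
    have h1 : MeasurableSet {y : ι → ℝ | ∑ j, (∑ i, A i j * (y i - θ0 i)) ^ 2 ≤ 2 * B / δ} :=
      measurableSet_le (by fun_prop) (by fun_prop)
    have h2 : MeasurableSet (⋂ p, {y : ι → ℝ | |∑ i, R i p * (y i - θ0 i)| ≤ lam}) := by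
      refine MeasurableSet.iInter fun p => measurableSet_le ?_ (by fun_prop)
      exact Measurable.abs (by fun_prop)
    convert h1.inter h2 using 1
    ext y
    simp [hG]
  have hsub : Gᶜ ⊆ {y | B / (δ / 2) ≤ ∑ j, (∑ i, A i j * (y i - θ0 i)) ^ 2} ∪
      ⋃ p, {y | lam ≤ |∑ i, R i p * (y i - θ0 i)|} := by
    intro y hy
    rw [Set.mem_compl_iff, hG, Set.mem_ofPred_eq, not_and_or] at hy
    rcases hy with hy | hy
    · left
      rw [Set.mem_ofPred_eq, div_div_eq_mul_div, mul_comm B]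
      exact (not_le.1 hy).le
    · right
      push Not at hy
      obtain ⟨p, hp⟩ := hy
      exact Set.mem_iUnion.2 ⟨p, hp.le⟩
  have hbad : (gaussSeq θ0 σ).real Gᶜ ≤ δ := by
    calc _ ≤ _ := measureReal_mono hsub
      _ ≤ _ := measureReal_union_le _ _
      _ ≤ δ / 2 + Fintype.card κ' * (2 * Real.exp (-lam ^ 2 / (2 * c))) := by
          refine add_le_add (measureReal_sum_sq_ge_le θ0 σ A hB (by positivity) hA) ?_
          refine (measureReal_iUnion_fintype_le _).trans ?_
          calc _ ≤ ∑ _p : κ', 2 * Real.exp (-lam ^ 2 / (2 * c)) :=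
                Finset.sum_le_sum fun p _ =>
                  measureReal_abs_sum_ge_le θ0 σ (fun i => R i p) hc (hR p) hlam
            _ = _ := by rw [Finset.sum_const, nsmul_eq_mul, Finset.card_univ]
      _ ≤ δ := by linarith
  rw [measureReal_compl hGm, probReal_univ] at hbad
  rw [← ofReal_measureReal]
  exact ENNReal.ofReal_le_ofReal (by linarith)

end Probability

section Estimation

lemma sum_sq_sub_le_of_basic_inequality {ι κ : Type*} [Fintype ι] [Fintype κ] [DecidableEq ι]
    {D : Matrix κ ι ℝ} {P : Matrix ι ι ℝ} {R : Matrix ι κ ℝ} (hPR : 1 - P = R * D)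
    {y θ0 θ : ι → ℝ} {lam a : ℝ}
    (hP : ∑ j, (∑ i, P i j * (y i - θ0 i)) ^ 2 ≤ a)
    (hR : ∀ p, |∑ i, R i p * (y i - θ0 i)| ≤ lam)
    (hbasic : (1 / 2) * ∑ x, (y x - θ x) ^ 2 + lam * ∑ p, |D.mulVec θ p| ≤
      (1 / 2) * ∑ x, (y x - θ0 x) ^ 2 + lam * ∑ p, |D.mulVec θ0 p|) :
    ∑ x, (θ x - θ0 x) ^ 2 ≤ 4 * a + 8 * (lam * ∑ p, |D.mulVec θ0 p|) := by
  set v : ι → ℝ := θ - θ0 with hv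
  set ε : ι → ℝ := y - θ0 with hε
  have hdecomp : v = P.mulVec v + R.mulVec (D.mulVec v) := by
    rw [Matrix.mulVec_mulVec, ← hPR, Matrix.sub_mulVec, Matrix.one_mulVec]
    abel
  have hinner : ∑ i, ε i * v i = ∑ j, (∑ i, P i j * ε i) * v j +
      ∑ p, (∑ i, R i p * ε i) * D.mulVec v p := by
    calc ∑ i, ε i * v i = ε ⬝ᵥ v := rfl
      _ = ε ⬝ᵥ P.mulVec v + ε ⬝ᵥ R.mulVec (D.mulVec v) := by
          conv_lhs => rw [hdecomp]
          rw [dotProduct_add]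
      _ = _ := by
          rw [Matrix.dotProduct_mulVec, Matrix.dotProduct_mulVec]
          simp only [dotProduct, Matrix.vecMul, mul_comm (ε _)]
  have h1 : ∑ j, (∑ i, P i j * ε i) * v j ≤ a + (1 / 4) * ∑ j, v j ^ 2 := by
    calc _ ≤ ∑ j, ((∑ i, P i j * ε i) ^ 2 + (1 / 4) * v j ^ 2) :=
          Finset.sum_le_sum fun j _ => by
            nlinarith [sq_nonneg ((∑ i, P i j * ε i) - v j / 2)]
      _ ≤ _ := by
          rw [Finset.sum_add_distrib, ← Finset.mul_sum]
          exact add_le_add_left hP _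
  have h2 : ∑ p, (∑ i, R i p * ε i) * D.mulVec v p ≤
      lam * ∑ p, |D.mulVec θ p| + lam * ∑ p, |D.mulVec θ0 p| := by
    rw [← mul_add, ← Finset.sum_add_distrib, Finset.mul_sum]
    refine Finset.sum_le_sum fun p _ => ?_
    have hlam : 0 ≤ lam := (abs_nonneg _).trans (hR p)
    calc _ ≤ |∑ i, R i p * ε i| * |D.mulVec v p| := by
          rw [← abs_mul]; exact le_abs_self _
      _ ≤ lam * |D.mulVec v p| := mul_le_mul_of_nonneg_right (hR p) (abs_nonneg _)
      _ ≤ _ := by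
          refine mul_le_mul_of_nonneg_left ?_ hlam
          rw [hv, Matrix.mulVec_sub, Pi.sub_apply]
          exact abs_sub _ _
  have h3 : ∑ x, (y x - θ x) ^ 2 =
      ∑ x, (y x - θ0 x) ^ 2 - 2 * ∑ i, ε i * v i + ∑ x, v x ^ 2 := by
    rw [Finset.mul_sum, ← Finset.sum_sub_distrib, ← Finset.sum_add_distrib]
    refine Finset.sum_congr rfl fun x _ => ?_
    simp only [hv, hε, Pi.sub_apply]
    ring
  have h4 : ∑ x, (θ x - θ0 x) ^ 2 = ∑ x, v x ^ 2 := rfl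
  rw [h3] at hbasic
  rw [h4]
  linarith

lemma exists_scale {Q : ℕ → Prop} {M : ℕ} (hQ : ∀ L, Q L → 2 ^ L ≤ M) :
    ∃ L, (L = 0 ∨ Q L) ∧ ¬ Q (L + 1) := by
  classical
  have hex : ∃ L, ¬ Q (L + 1) := by
    refine ⟨M, fun h => ?_⟩
    have h1 := hQ _ h
    have h2 : M < 2 ^ M := Nat.lt_two_pow_self
    have h3 : 2 ^ M ≤ 2 ^ (M + 1) := Nat.pow_le_pow_right (by norm_num) (by omega)
    omega
  refine ⟨Nat.find hex, ?_, Nat.find_spec hex⟩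
  rcases h : Nat.find hex with _ | L
  · exact Or.inl rfl
  · refine Or.inr (not_not.1 (Nat.find_min hex (m := L) (by omega)))

lemma pow_div_le_of_lt {N m d r : ℕ} (hm : 0 < m) (h : N < 2 * (r * (2 * m))) :
    ((N ^ d : ℕ) : ℝ) / (m : ℝ) ^ d ≤ (4 * r : ℝ) ^ d := by
  have hm' : (0 : ℝ) < m := by exact_mod_cast hm
  rw [div_le_iff₀ (by positivity), ← mul_pow]
  push_cast
  refine pow_le_pow_left₀ (by positivity) ?_ d
  have : (N : ℝ) < 2 * (r * (2 * m)) := by exact_mod_cast h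
  linarith

lemma exists_scale_of_le {k d N : ℕ} (hkd : 2 * (k + 1) ≤ d) (hN : k + 1 < N) {lam₀ C : ℝ}
    (hlam : 0 < lam₀) (hC : 0 < C)
    (hlt : 2 * (k + 1) < d → lam₀ = Real.sqrt (Real.log ((N ^ d : ℕ) : ℝ)))
    (heq : 2 * (k + 1) = d → lam₀ = Real.log ((N ^ d : ℕ) : ℝ)) :
    ∃ L : ℕ, (L = 0 ∨ 2 * ((k + 1) * 2 ^ L) ≤ N) ∧
      Real.log ((N ^ d : ℕ) : ℝ) *
        ∑ l ∈ Finset.range L, ((2 : ℝ) ^ (2 * (k + 1)) / 2 ^ d) ^ l ≤ 2 * lam₀ ^ 2 ∧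
      ((N ^ d : ℕ) : ℝ) / ((2 ^ L : ℕ) : ℝ) ^ d ≤
        (4 * (k + 1 : ℕ) : ℝ) ^ d * (1 + lam₀ * C) := by
  have hlog : 0 ≤ Real.log ((N ^ d : ℕ) : ℝ) := Real.log_natCast_nonneg _
  have hQ : ∀ L, 2 * ((k + 1) * 2 ^ L) ≤ N → 2 ^ L ≤ N := fun L h => by
    nlinarith [Nat.zero_le (k * 2 ^ L)]
  obtain ⟨L, hL, hL'⟩ := exists_scale hQ
  refine ⟨L, hL, ?_, ?_⟩
  · rcases hkd.lt_or_eq with h | h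
    · rw [hlt h, Real.sq_sqrt hlog, mul_comm]
      refine mul_le_mul_of_nonneg_right ?_ hlog
      have hρ : (2 : ℝ) ^ (2 * (k + 1)) / 2 ^ d ≤ 1 / 2 := by
        rw [div_le_div_iff₀ (by positivity) (by norm_num), ← pow_succ, one_mul]
        exact pow_le_pow_right₀ (by norm_num) h
      calc _ ≤ ∑ l ∈ Finset.range L, (1 / 2 : ℝ) ^ l := by gcongr
        _ ≤ 2 := sum_geometric_two_le L
    · have hρ : (2 : ℝ) ^ (2 * (k + 1)) / 2 ^ d = 1 := by
        rw [h, div_self (by positivity)]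
      rw [heq h, hρ]
      simp only [one_pow, Finset.sum_const, Finset.card_range, nsmul_eq_mul, mul_one]
      have hLle : (L : ℝ) ≤ 2 * Real.log ((N ^ d : ℕ) : ℝ) := by
        rcases hL with hL | hL
        · simpa [hL] using hlog
        · have h1 : 2 ^ L ≤ N ^ d := (hQ L hL).trans (Nat.le_self_pow (by omega) N)
          have h2 : Real.log ((2 : ℝ) ^ L) ≤ Real.log ((N ^ d : ℕ) : ℝ) :=
            Real.log_le_log (by positivity) (by exact_mod_cast h1)
          rw [Real.log_pow] at h2
          have h3 : (1 / 2 : ℝ) ≤ Real.log 2 := by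
            have := Real.log_two_gt_d9; linarith
          nlinarith [Nat.cast_nonneg (α := ℝ) L]
      nlinarith
  · have h1 := pow_div_le_of_lt (d := d) (N := N) (m := 2 ^ L) (r := k + 1) (by positivity)
      (by rw [pow_succ'] at hL'; exact not_le.1 hL')
    refine h1.trans (le_mul_of_one_le_right (by positivity) ?_)
    have := mul_pos hlam hC
    linarith

lemma exists_scale_of_lt {k d N : ℕ} (hkd : d < 2 * (k + 1)) {lam₀ C : ℝ}
    (hlam : 0 < lam₀) (hC : 0 < C) (hlog : 0 < Real.log ((N ^ d : ℕ) : ℝ))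
    (hpow : lam₀ ^ (2 * (k + 1) - d + 2 * d) =
      Real.log ((N ^ d : ℕ) : ℝ) ^ d * (((N ^ d : ℕ) : ℝ) / C) ^ (2 * (k + 1) - d)) :
    ∃ L : ℕ, (L = 0 ∨ 2 * ((k + 1) * 2 ^ L) ≤ N) ∧
      Real.log ((N ^ d : ℕ) : ℝ) *
        ∑ l ∈ Finset.range L, ((2 : ℝ) ^ (2 * (k + 1)) / 2 ^ d) ^ l ≤ 2 * lam₀ ^ 2 ∧
      ((N ^ d : ℕ) : ℝ) / ((2 ^ L : ℕ) : ℝ) ^ d ≤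
        (4 * (k + 1 : ℕ) : ℝ) ^ d * (1 + lam₀ * C) := by
  obtain ⟨e, he⟩ := Nat.exists_eq_add_of_lt hkd
  have he' : 2 * (k + 1) - d = e + 1 := by omega
  rw [he'] at hpow
  have hρ : (2 : ℝ) ^ (2 * (k + 1)) / 2 ^ d = 2 ^ (e + 1) := by
    rw [div_eq_iff (by positivity), ← pow_add]
    congr 1
    omega
  rw [hρ]
  set g := Real.log ((N ^ d : ℕ) : ℝ) with hg
  have hlc := mul_pos hlam hC
  have hQ : ∀ L, (2 * ((k + 1) * 2 ^ L) ≤ N ∧ g * ((2 : ℝ) ^ (e + 1)) ^ L ≤ lam₀ ^ 2) →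
      2 ^ L ≤ N := fun L h => by
    nlinarith [Nat.zero_le (k * 2 ^ L), h.1]
  obtain ⟨L, hL, hL'⟩ := exists_scale hQ
  refine ⟨L, hL.imp_right And.left, ?_, ?_⟩
  · rcases hL with hL | hL
    · rw [hL]
      simp only [Finset.range_zero, Finset.sum_empty, mul_zero]
      positivity
    · have h2 : (2 : ℝ) ≤ 2 ^ (e + 1) := le_self_pow₀ (by norm_num) (by omega)
      have h1 : ∑ l ∈ Finset.range L, ((2 : ℝ) ^ (e + 1)) ^ l ≤ ((2 : ℝ) ^ (e + 1)) ^ L := by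
        have h3 := geom_sum_mul ((2 : ℝ) ^ (e + 1)) L
        have h4 : 0 ≤ ∑ l ∈ Finset.range L, ((2 : ℝ) ^ (e + 1)) ^ l :=
          Finset.sum_nonneg fun _ _ => by positivity
        nlinarith
      have h5 := mul_le_mul_of_nonneg_left h1 hlog.le
      nlinarith [hL.2, sq_nonneg lam₀]
  · rw [not_and_or] at hL'
    rcases hL' with hL' | hL'
    · have h1 := pow_div_le_of_lt (d := d) (N := N) (m := 2 ^ L) (r := k + 1) (by positivity)
        (by rw [pow_succ'] at hL'; exact not_le.1 hL')
      exact h1.trans (le_mul_of_one_le_right (by positivity) (by linarith))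
    · have h1 : lam₀ ^ 2 ≤ g * ((2 : ℝ) ^ (e + 1)) ^ (L + 1) := (not_le.1 hL').le
      have h2 : (((N ^ d : ℕ) : ℝ) / C) ^ (e + 1) ≤ (lam₀ * (2 ^ (L + 1)) ^ d) ^ (e + 1) := by
        have h3 : g ^ d * (((N ^ d : ℕ) : ℝ) / C) ^ (e + 1) ≤
            g ^ d * (lam₀ * (2 ^ (L + 1)) ^ d) ^ (e + 1) := by
          rw [← hpow]
          calc lam₀ ^ (e + 1 + 2 * d) = lam₀ ^ (e + 1) * (lam₀ ^ 2) ^ d := by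
                rw [pow_add, pow_mul]
            _ ≤ lam₀ ^ (e + 1) * (g * ((2 : ℝ) ^ (e + 1)) ^ (L + 1)) ^ d := by gcongr
            _ = _ := by ring
        exact le_of_mul_le_mul_left h3 (by positivity)
      have h4 : ((N ^ d : ℕ) : ℝ) / C ≤ lam₀ * (2 ^ (L + 1)) ^ d :=
        le_of_pow_le_pow_left₀ (by omega) (by positivity) h2
      rw [div_le_iff₀ hC] at h4
      have h5 : (2 : ℝ) ^ d ≤ (4 * (k + 1 : ℕ) : ℝ) ^ d := by
        refine pow_le_pow_left₀ (by norm_num) ?_ d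
        push_cast
        have := Nat.cast_nonneg (α := ℝ) k
        linarith
      rw [div_le_iff₀ (by positivity)]
      calc _ ≤ _ := h4
        _ = 2 ^ d * (lam₀ * C) * ((2 ^ L : ℕ) : ℝ) ^ d := by
            push_cast
            rw [pow_succ 2 L, mul_pow]
            ring
        _ ≤ _ := by
            gcongr
            linarith

lemma card_KtfIdx_le {N d m : ℕ} : Fintype.card (KtfIdx N d m) ≤ d * N ^ d := by
  rw [Fintype.card_sigma]
  calc _ ≤ ∑ _j : Fin d, N ^ d := by
        refine Finset.sum_le_sum fun j _ => ?_
        have hd : d = d - 1 + 1 := by have := j.pos; omega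
        have hcard : Fintype.card {l : Fin d // l ≠ j} = d - 1 := by simp
        rw [Fintype.card_prod, Fintype.card_fun, hcard, Fintype.card_fin, Fintype.card_fin]
        conv_rhs => rw [hd, pow_succ']
        exact Nat.mul_le_mul_right _ (Nat.sub_le _ _)
    _ = _ := by simp

lemma mul_exp_neg_log_le {n b : ℝ} (hn : 2 ≤ n) (hb : 0 < b) :
    n * Real.exp (-(1 + b) * Real.log n) ≤ 2 / b := by
  have hn0 : 0 < n := by linarith
  have h1 : n * Real.exp (-(1 + b) * Real.log n) = Real.exp (-(b * Real.log n)) := by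
    nth_rewrite 1 [← Real.exp_log hn0]
    rw [← Real.exp_add]
    congr 1
    ring
  have h2 : (1 / 2 : ℝ) ≤ Real.log n := by
    have h3 := Real.log_le_log (by norm_num) hn
    have := Real.log_two_gt_d9
    linarith
  have h4 : b / 2 ≤ Real.exp (b * Real.log n) := by
    have := Real.add_one_le_exp (b * Real.log n)
    nlinarith
  rw [h1, Real.exp_neg, inv_le_comm₀ (by positivity) (by positivity), inv_div]
  exact h4

/-- The tuning parameter of `ktf_error_bound` with unit constant. -/
def baseLambda (k d : ℕ) (n C : ℝ) : ℝ :=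
  if 2 * (k + 1) < d then Real.sqrt (Real.log n)
  else if 2 * (k + 1) = d then Real.log n
  else Real.log n ^ ((1 : ℝ) / (2 * (((k : ℝ) + 1) / d) + 1)) *
    (n / C) ^ ((2 * (((k : ℝ) + 1) / d) - 1) / (2 * (((k : ℝ) + 1) / d) + 1))

lemma baseLambda_pos {k d : ℕ} {n C : ℝ} (hn : 1 < n) (hC : 0 < C) :
    0 < baseLambda k d n C := by
  have hlog := Real.log_pos hn
  have hn0 : 0 < n := by linarith
  unfold baseLambda
  split_ifs
  · exact Real.sqrt_pos.2 hlog
  · exact hlog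
  · exact mul_pos (Real.rpow_pos_of_pos hlog _) (Real.rpow_pos_of_pos (div_pos hn0 hC) _)

lemma baseLambda_pow {k d : ℕ} (hd : 1 ≤ d) (hkd : d < 2 * (k + 1)) {n C : ℝ} (hn : 1 < n)
    (hC : 0 < C) :
    baseLambda k d n C ^ (2 * (k + 1) - d + 2 * d) =
      Real.log n ^ d * (n / C) ^ (2 * (k + 1) - d) := by
  have hlog := Real.log_pos hn
  have hnC : 0 < n / C := div_pos (by linarith) hC
  have hd' : (0 : ℝ) < d := by exact_mod_cast hd
  have hk' : (0 : ℝ) ≤ k := Nat.cast_nonneg k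
  rw [baseLambda, if_neg (by omega), if_neg (by omega), mul_pow, ← Real.rpow_natCast (_ ^ _),
    ← Real.rpow_natCast ((n / C) ^ _), ← Real.rpow_mul hlog.le, ← Real.rpow_mul hnC.le,
    ← Real.rpow_natCast _ d, ← Real.rpow_natCast _ (2 * (k + 1) - d)]
  push_cast [Nat.cast_sub hkd.le]
  congr 2 <;> field_simp <;> ring

lemma exists_scale_baseLambda {k d N : ℕ} (hd : 1 ≤ d) (hN : k + 1 < N) {C : ℝ} (hC : 0 < C) :
    ∃ L : ℕ, (L = 0 ∨ 2 * ((k + 1) * 2 ^ L) ≤ N) ∧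
      Real.log ((N ^ d : ℕ) : ℝ) *
        ∑ l ∈ Finset.range L, ((2 : ℝ) ^ (2 * (k + 1)) / 2 ^ d) ^ l ≤
          2 * baseLambda k d ((N ^ d : ℕ) : ℝ) C ^ 2 ∧
      ((N ^ d : ℕ) : ℝ) / ((2 ^ L : ℕ) : ℝ) ^ d ≤
        (4 * (k + 1 : ℕ) : ℝ) ^ d * (1 + baseLambda k d ((N ^ d : ℕ) : ℝ) C * C) := by
  have hn : (1 : ℝ) < ((N ^ d : ℕ) : ℝ) := by
    exact_mod_cast Nat.one_lt_pow (by omega) (by omega)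
  have hpos := baseLambda_pos (k := k) (d := d) hn hC
  rcases lt_or_ge d (2 * (k + 1)) with h | h
  · exact exists_scale_of_lt h hpos hC (Real.log_pos hn) (baseLambda_pow hd h hn hC)
  · refine exists_scale_of_le h hN hpos hC (fun h1 => ?_) fun h1 => ?_
    · rw [baseLambda, if_pos h1]
    · rw [baseLambda, if_neg (by omega), if_pos h1]

end Estimation

/-- Theorem 3: estimation error of Kronecker trend filtering.
With `s = (k+1)/d` and `C_n = ‖D_{n,d}^{(k+1)} θ₀‖₁ > 0`, there are constants
`c₁, c₂ > 0` (depending only on `k, d, σ, δ`) such that the KTF estimator with tuning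
parameter `λ = c₁ √(log n)` if `s < 1/2`, `λ = c₁ log n` if `s = 1/2`, and
`λ = c₁ (log n)^{1/(2s+1)} (n/C_n)^{(2s-1)/(2s+1)}` if `s > 1/2`, satisfies
`(1/n)‖θ̂ - θ₀‖₂² ≤ c₂ (1/n + λ C_n/n)` with probability at least `1-δ`. -/
theorem ktf_error_bound (k d : ℕ) (hd : 1 ≤ d) (σ : ℝ) (hσ : 0 < σ)
    (δ : ℝ) (hδ0 : 0 < δ) (hδ1 : δ < 1) :
    ∃ c₁ : ℝ, 0 < c₁ ∧ ∃ c₂ : ℝ, 0 < c₂ ∧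
      ∀ N : ℕ, k + 1 < N →
      ∀ θ0 : (Fin d → Fin N) → ℝ,
        0 < ∑ p, |(ktfMat N d (k + 1)).mulVec θ0 p| →
      ∀ lam : ℝ,
        lam = (if 2 * (k + 1) < d then c₁ * Real.sqrt (Real.log ((N ^ d : ℕ) : ℝ))
          else if 2 * (k + 1) = d then c₁ * Real.log ((N ^ d : ℕ) : ℝ)
          else c₁ * Real.log ((N ^ d : ℕ) : ℝ) ^
                ((1 : ℝ) / (2 * (((k : ℝ) + 1) / d) + 1)) *
              (((N ^ d : ℕ) : ℝ) / ∑ p, |(ktfMat N d (k + 1)).mulVec θ0 p|) ^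
                ((2 * (((k : ℝ) + 1) / d) - 1) / (2 * (((k : ℝ) + 1) / d) + 1))) →
      ∀ θhat : ((Fin d → Fin N) → ℝ) → ((Fin d → Fin N) → ℝ),
        (∀ y θ' : (Fin d → Fin N) → ℝ,
          (1 / 2) * ∑ x, (y x - θhat y x) ^ 2 +
              lam * ∑ p, |(ktfMat N d (k + 1)).mulVec (θhat y) p| ≤
            (1 / 2) * ∑ x, (y x - θ' x) ^ 2 +
              lam * ∑ p, |(ktfMat N d (k + 1)).mulVec θ' p|) →
        gaussSeq θ0 σ
            {y | (1 / ((N ^ d : ℕ) : ℝ)) * ∑ x, (θhat y x - θ0 x) ^ 2 ≤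
              c₂ * (1 / ((N ^ d : ℕ) : ℝ) +
                lam * (∑ p, |(ktfMat N d (k + 1)).mulVec θ0 p|) / ((N ^ d : ℕ) : ℝ))} ≥
          ENNReal.ofReal (1 - δ) := by
  set n₁ : ℝ := (2 ^ (k + 2)) ^ d * (2 ^ (k + 1)) ^ d with hn₁
  set n₂ : ℝ := (4 * ((k + 1 : ℕ) : ℝ)) ^ d with hn₂
  set q : ℝ := 3 * ((2 ^ (k + 3)) ^ d) ^ 2 with hq
  set b : ℝ := 8 * d / δ with hb
  have hd0 : (0 : ℝ) < d := by exact_mod_cast hd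
  have hn₁0 : 0 < n₁ := by positivity
  have hn₂0 : 0 < n₂ := by positivity
  have hq0 : 0 < q := by positivity
  have hb0 : 0 < b := by positivity
  set c₁ : ℝ := √(4 * σ ^ 2 * q * (1 + b)) with hc₁
  have hc₁0 : 0 < c₁ := Real.sqrt_pos.2 (by positivity)
  have hc₁sq : c₁ ^ 2 = 4 * σ ^ 2 * q * (1 + b) := Real.sq_sqrt (by positivity)
  set a : ℝ := 8 * σ ^ 2 * (n₁ * n₂) / δ with ha
  have ha0 : 0 < a := by positivity
  refine ⟨c₁, hc₁0, a * (1 + 1 / c₁) + 8, by positivity, ?_⟩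
  intro N hN θ0 hC lam hlam θhat hmin
  set C : ℝ := ∑ p, |(ktfMat N d (k + 1)).mulVec θ0 p| with hCdef
  set lam₀ : ℝ := baseLambda k d ((N ^ d : ℕ) : ℝ) C with hlam₀
  have hlam' : lam = c₁ * lam₀ := by
    rw [hlam, hlam₀, baseLambda]
    split_ifs <;> ring
  have hn2 : (2 : ℝ) ≤ ((N ^ d : ℕ) : ℝ) := by
    have : 2 ≤ N ^ d := le_trans (by omega) (Nat.le_self_pow (by omega) N)
    exact_mod_cast this
  obtain ⟨L, hL, hLS, hLm⟩ := exists_scale_baseLambda hd hN hC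
  set n : ℝ := ((N ^ d : ℕ) : ℝ) with hn
  have hn0 : 0 < n := by linarith
  have hlog : 0 < Real.log n := Real.log_pos (by linarith)
  have hlam₀0 : 0 < lam₀ := baseLambda_pos (by linarith) hC
  have hlam0 : 0 < lam := hlam' ▸ mul_pos hc₁0 hlam₀0
  set B : ℝ := σ ^ 2 * (n₁ * n₂ * (1 + lam₀ * C)) with hB
  set c : ℝ := σ ^ 2 * (q * (2 * lam₀ ^ 2 / Real.log n)) with hc
  have hB0 : 0 < B := by positivity
  have hc0 : 0 < c := by positivity
  have hP : σ ^ 2 * ∑ y, ∑ x, (smoothMat (k + 1) (2 ^ L) :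
      Matrix (Fin d → Fin N) (Fin d → Fin N) ℝ) x y ^ 2 ≤ B := by
    refine mul_le_mul_of_nonneg_left ?_ (by positivity)
    refine (sum_sq_smoothMat_le (k + 1) (m := 2 ^ L) (by positivity)).trans ?_
    calc _ = n₁ * (n / ((2 ^ L : ℕ) : ℝ) ^ d) := by rw [div_pow]; ring
      _ ≤ n₁ * (n₂ * (1 + lam₀ * C)) := by gcongr
      _ = _ := by ring
  have hR : ∀ p : KtfIdx N d (k + 1), σ ^ 2 * ∑ x, telescopeMat (k + 1) L x p ^ 2 ≤ c := by
    intro p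
    refine mul_le_mul_of_nonneg_left ((sum_sq_telescopeMat_le k L p).trans ?_) (by positivity)
    refine mul_le_mul_of_nonneg_left ?_ hq0.le
    rw [le_div_iff₀ hlog]
    linarith
  have htail : Fintype.card (KtfIdx N d (k + 1)) * (2 * Real.exp (-lam ^ 2 / (2 * c))) ≤
      δ / 2 := by
    have hexp : -lam ^ 2 / (2 * c) = -(1 + b) * Real.log n := by
      rw [hlam', mul_pow, hc₁sq, hc]
      field_simp
      ring
    have hcard : (Fintype.card (KtfIdx N d (k + 1)) : ℝ) ≤ d * n := by
      rw [hn]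
      exact_mod_cast card_KtfIdx_le (N := N) (d := d) (m := k + 1)
    rw [hexp]
    calc _ ≤ d * n * (2 * Real.exp (-(1 + b) * Real.log n)) := by gcongr
      _ = 2 * d * (n * Real.exp (-(1 + b) * Real.log n)) := by ring
      _ ≤ 2 * d * (2 / b) := by gcongr; exact mul_exp_neg_log_le hn2 hb0
      _ = δ / 2 := by rw [hb]; field_simp; norm_num
  refine (ofReal_le_gaussSeq_good θ0 σ _ _ hB0 hc0 hδ0 hlam0.le hP hR htail).trans
    (measure_mono ?_)
  rintro y ⟨hy₁, hy₂⟩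
  have hmain := sum_sq_sub_le_of_basic_inequality (one_sub_smoothMat (by omega) L hL) hy₁ hy₂
    (hmin y θ0)
  rw [← hCdef] at hmain
  have hbound : ∑ x, (θhat y x - θ0 x) ^ 2 ≤ (a * (1 + 1 / c₁) + 8) * (1 + lam * C) := by
    have h₁ : 4 * (2 * B / δ) = a * (1 + 1 / c₁ * (lam * C)) := by
      rw [hlam', ha, hB]
      field_simp
      norm_num
    have h₂ : 0 ≤ a * (1 / c₁) := by positivity
    have h₃ : 0 ≤ a * (lam * C) := by positivity
    rw [h₁] at hmain
    linarith
  change 1 / n * _ ≤ (a * (1 + 1 / c₁) + 8) * (1 / n + lam * C / n)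
  calc _ ≤ 1 / n * ((a * (1 + 1 / c₁) + 8) * (1 + lam * C)) := by gcongr
    _ = _ := by ring
end
end
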